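/- arXiv:1108.5708 — 2 statements merged into one kernel-verified Lean document; each statement's English description precedes it below -/
import Mathlib

section
/- Let R be a chain ring, Z its set of zero-divisors (a prime ideal), and Q = R_Z. Let E be an indecomposable injective R-module with E_♯ ⊆ Z. If the set 𝒜(E) = {(0 : x) : x ∈ E, x ≠ 0} of annihilator ideals of E is not equal to the set of ideals of R of the form qQ (the contraction to R of the principal ideal of Q generated by q) for nonzero q ∈ Z, then E is a flat R-module. -/
open DirectSum


universe u v

/-- `gen M ≤ n`: `M` is generated by at most `n` elements. -/
def GenLE (R : Type u) [Semiring R] (M : Type v) [AddCommMonoid M] [Module R M] (n : ℕ) : Prop :=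
  ∃ s : Finset M, s.card ≤ n ∧ Submodule.span R (s : Set M) = ⊤

/-- The Malcev rank of `M` is at most `n`: every finitely generated submodule of `M`
is generated by at most `n` elements. -/
def MalcevRankLE (R : Type u) [Semiring R] (M : Type v) [AddCommMonoid M] [Module R M]
    (n : ℕ) : Prop :=
  ∀ X : Submodule R M, X.FG →
    ∃ s : Finset M, (s : Set M) ⊆ (X : Set M) ∧ s.card ≤ n ∧ Submodule.span R (s : Set M) = X

/-- An indecomposable (nonzero) module. -/
def IsIndecomposable (R : Type u) [Semiring R] (M : Type v) [AddCommMonoid M] [Module R M] :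
    Prop :=
  (∃ x : M, x ≠ 0) ∧ ¬∃ A B : Submodule R M, A ≠ ⊥ ∧ B ≠ ⊥ ∧ IsCompl A B

/-- A uniform module. -/
def IsUniformModule (R : Type u) [Semiring R] (M : Type v) [AddCommMonoid M] [Module R M] :
    Prop :=
  (∃ x : M, x ≠ 0) ∧ ∀ A B : Submodule R M, A ≠ ⊥ → B ≠ ⊥ → A ⊓ B ≠ ⊥

/-- A pure submodule: tensoring with any module preserves injectivity of the inclusion. -/
def IsPureSubmodule (R : Type u) [CommRing R] {M : Type v} [AddCommGroup M] [Module R M]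
    (A : Submodule R M) : Prop :=
  ∀ (C : Type (max u v)) [AddCommGroup C] [Module R C],
    Function.Injective (LinearMap.rTensor C A.subtype)

/-- A uniserial module: submodules are totally ordered. -/
def IsUniserialModule (R : Type u) [Semiring R] (M : Type v) [AddCommMonoid M] [Module R M] :
    Prop :=
  ∀ A B : Submodule R M, A ≤ B ∨ B ≤ A

/-- A polyserial module: it has a pure-composition series with uniserial factors. -/
def IsPolyserial (R : Type u) [CommRing R] (M : Type v) [AddCommGroup M] [Module R M] : Prop :=
  ∃ (n : ℕ) (F : Fin (n + 1) → Submodule R M),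
    F 0 = ⊥ ∧ F (Fin.last n) = ⊤ ∧ StrictMono F ∧
    (∀ i, IsPureSubmodule R (F i)) ∧
    ∀ i : Fin n,
      IsUniserialModule R (↥(F i.succ) ⧸ Submodule.comap (F i.succ).subtype (F i.castSucc))

/-- A pure-injective module. -/
def IsPureInjective (R : Type u) [CommRing R] (F : Type v) [AddCommGroup F] [Module R F] :
    Prop :=
  ∀ (B : Type (max u v)) [AddCommGroup B] [Module R B] (A : Submodule R B),
    IsPureSubmodule R A → ∀ f : A →ₗ[R] F, ∃ g : B →ₗ[R] F, ∀ a : A, g a = f a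

/-- `B` is a pure-essential extension of its submodule `A`. -/
def IsPureEssentialExtension (R : Type u) [CommRing R] {B : Type v} [AddCommGroup B]
    [Module R B] (A : Submodule R B) : Prop :=
  IsPureSubmodule R A ∧
  ∀ K : Submodule R B, K ⊓ A = ⊥ → IsPureSubmodule R (A.map K.mkQ) → K = ⊥

/-- A maximal ring: every finitely solvable family of congruences is solvable. -/
def IsMaximalCR (R : Type u) [CommRing R] : Prop :=
  ∀ (ι : Type u) (a : ι → R) (A : ι → Ideal R),
    (∀ s : Finset ι, ∃ x : R, ∀ i ∈ s, x - a i ∈ A i) → ∃ x : R, ∀ i, x - a i ∈ A i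

/-- An almost maximal ring. -/
def IsAlmostMaximalCR (R : Type u) [CommRing R] : Prop :=
  ∀ (ι : Type u) (a : ι → R) (A : ι → Ideal R), (⨅ i, A i) ≠ ⊥ →
    (∀ s : Finset ι, ∃ x : R, ∀ i ∈ s, x - a i ∈ A i) → ∃ x : R, ∀ i, x - a i ∈ A i

/-- `M_♯`, the bottom prime ideal associated with `M`, as a set. -/
def sharpSet (R : Type u) [CommRing R] (M : Type v) [AddCommGroup M] [Module R M] : Set R :=
  {s : R | ∃ x : M, x ≠ 0 ∧ s • x = 0}

/-- The set of zero-divisors of `R`. -/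
def zeroDivisorsSet (R : Type u) [CommRing R] : Set R :=
  {r : R | ∃ s : R, s ≠ 0 ∧ r * s = 0}

/-- Finite Goldie dimension: every independent family of nonzero submodules is finite. -/
def HasFiniteGoldieDimension (R : Type u) [Semiring R] (M : Type v) [AddCommMonoid M]
    [Module R M] : Prop :=
  ∀ (ι : Type v) (f : ι → Submodule R M), (∀ i, f i ≠ ⊥) →
    (∀ i, f i ⊓ (⨆ j : {j : ι // j ≠ i}, f j.1) = ⊥) → Finite ι

/-- A superfluous (small) submodule. -/
def IsSuperfluous {R : Type u} [Semiring R] {M : Type v} [AddCommMonoid M] [Module R M]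
    (K : Submodule R M) : Prop :=
  ∀ G : Submodule R M, K ⊔ G = ⊤ → G = ⊤

/-- A co-uniform (hollow) module. -/
def IsCouniform (R : Type u) [Semiring R] (M : Type v) [AddCommMonoid M] [Module R M] : Prop :=
  (∃ x : M, x ≠ 0) ∧ ∀ K : Submodule R M, K ≠ ⊤ → IsSuperfluous K

/-- An essential submodule. -/
def IsEssentialSubmodule {R : Type u} [Semiring R] {M : Type v} [AddCommMonoid M] [Module R M]
    (A : Submodule R M) : Prop :=
  ∀ K : Submodule R M, K ⊓ A = ⊥ → K = ⊥

/-- `M` has dual Goldie dimension `n`. -/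
def HasDualGoldieDim (R : Type u) [Ring R] (M : Type v) [AddCommGroup M] [Module R M]
    (n : ℕ) : Prop :=
  ∃ (N : Fin n → Type v) (hab : ∀ i, AddCommGroup (N i)),
    letI := hab
    ∃ hmod : ∀ i, Module R (N i),
      letI := hmod
      ∃ φ : M →ₗ[R] ⨁ i, N i,
        Function.Surjective φ ∧ IsSuperfluous (LinearMap.ker φ) ∧ ∀ i, IsCouniform R (N i)

/-- In a module, every submodule disjoint from `B` lies in one that is maximal with this
property. -/
theorem exists_le_maximal_disjoint {R : Type*} {M : Type*} [Semiring R] [AddCommMonoid M]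
    [Module R M] {A B : Submodule R M} (h : Disjoint A B) :
    ∃ C, A ≤ C ∧ Maximal (fun X : Submodule R M => Disjoint X B) C := by
  refine zorn_le_nonempty₀ {X : Submodule R M | Disjoint X B} ?_ A h
  intro c hc hchain y hy
  refine ⟨sSup c, ?_, fun z hz => le_sSup hz⟩
  have hdir : DirectedOn (· ≤ ·) c := hchain.directedOn
  exact (hdir.disjoint_sSup_left).2 fun X hX => hc hX

/-- An indecomposable injective module is uniform. -/
theorem IsIndecomposable.isUniformModule {R : Type u} [CommRing R] {E : Type u} [AddCommGroup E]
    [Module R E] (hinj : Module.Injective R E) (hind : IsIndecomposable R E) :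
    IsUniformModule R E := by
  refine ⟨hind.1, fun A B hA hB hAB => hind.2 ?_⟩
  obtain ⟨C, hAC, hC⟩ := exists_le_maximal_disjoint (disjoint_iff.2 hAB)
  obtain ⟨D, hBD, hD⟩ := exists_le_maximal_disjoint hC.1.symm
  have hDC : Disjoint D C := hD.1
  have hzero : ∀ x, x ∈ C → x ∈ D → x = 0 := fun x hx hx' =>
    Submodule.disjoint_def.1 hDC x hx' hx
  obtain ⟨g, hg⟩ := hinj.out (D.mkQ ∘ₗ C.subtype) (by
    rw [← LinearMap.ker_eq_bot, LinearMap.ker_eq_bot']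
    intro c hc
    have : (c : E) ∈ D := by simpa using hc
    exact Subtype.ext (hzero c c.2 this)) C.subtype
  have hgC : ∀ c ∈ C, g (D.mkQ c) = c := fun c hc => hg ⟨c, hc⟩
  have hgD : ∀ d ∈ D, g (D.mkQ d) = 0 := fun d hd => by
    rw [(Submodule.Quotient.mk_eq_zero D).2 hd |> (show D.mkQ d = 0 from ·), map_zero]
  have hker : ∀ e, g (D.mkQ e) = 0 → e ∈ D := by
    intro e he
    have hle : LinearMap.ker (g ∘ₗ D.mkQ) ≤ D := by
      refine hD.2 (Submodule.disjoint_def.2 ?_) fun d hd => hgD d hd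
      intro x hx hxC
      rw [← hgC x hxC]
      exact hx
    exact hle he
  have hrange : ∀ e, g (D.mkQ e) ∈ C := by
    intro e
    have hle : LinearMap.range (g ∘ₗ D.mkQ) ≤ C := by
      refine hC.2 ?_ fun c hc => ⟨c, hgC c hc⟩
      refine Disjoint.mono_right hBD ?_
      rw [Submodule.disjoint_def]
      rintro _ ⟨e, rfl⟩ hy
      by_contra hne
      have heD : e ∉ D := fun he => hne (hgD e he)
      refine heD ?_
      have hsup : D ⊔ Submodule.span R {e} ≤ D := by
        refine hD.2 (Submodule.disjoint_def.2 ?_) le_sup_left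
        intro x hx hxC
        obtain ⟨d, hd, z, hz, rfl⟩ := Submodule.mem_sup.1 hx
        obtain ⟨r, rfl⟩ := Submodule.mem_span_singleton.1 hz
        refine hzero _ hxC ?_
        have h1 := hgC _ hxC
        rw [map_add, map_add, hgD d hd, zero_add, map_smul, map_smul] at h1
        rw [← h1]
        exact D.smul_mem r hy
      exact hsup (Submodule.mem_sup_right (Submodule.mem_span_singleton_self e))
    exact hle ⟨e, rfl⟩
  refine ⟨C, D, ?_, ?_, hDC.symm, ?_⟩
  · rintro rfl; exact hA (le_bot_iff.1 hAC)
  · rintro rfl; exact hB (le_bot_iff.1 hBD)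
  · rw [codisjoint_iff_le_sup]
    intro e _
    refine Submodule.mem_sup.2 ⟨g (D.mkQ e), hrange e, e - g (D.mkQ e), hker _ ?_, by abel⟩
    rw [map_sub, map_sub, hgC _ (hrange e), sub_self]

/-- Elements of an injective module are divisible by every scalar allowed by annihilators. -/
theorem Module.Injective.exists_smul_eq {R : Type u} [CommRing R] {E : Type u} [AddCommGroup E]
    [Module R E] (hinj : Module.Injective R E) {b : R} {x : E}
    (h : ∀ d : R, d * b = 0 → d • x = 0) : ∃ y : E, b • y = x := by
  let I : Ideal R := LinearMap.ker (LinearMap.toSpanSingleton R R b)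
  obtain ⟨g, hg⟩ := hinj.out (I.liftQ (LinearMap.toSpanSingleton R R b) le_rfl)
    (by
      rw [← LinearMap.ker_eq_bot]
      exact Submodule.ker_liftQ_eq_bot _ _ _ le_rfl)
    (I.liftQ (LinearMap.toSpanSingleton R E x) (fun d hd => h d hd))
  refine ⟨g 1, ?_⟩
  have hone : g ((1 : R) • b) = (1 : R) • x := hg (Submodule.Quotient.mk 1)
  rw [← map_smul, smul_eq_mul, mul_one, ← one_smul R b, hone, one_smul]

section ChainRing

variable {R : Type u} [CommRing R]

theorem dvd_total_of_ideals (hchain : ∀ I J : Ideal R, I ≤ J ∨ J ≤ I) (a b : R) :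
    a ∣ b ∨ b ∣ a :=
  (hchain (Ideal.span {b}) (Ideal.span {a})).imp Ideal.span_singleton_le_span_singleton.1
    Ideal.span_singleton_le_span_singleton.1

theorem isBezout_of_dvd_total (htot : ∀ a b : R, a ∣ b ∨ b ∣ a) : IsBezout R := by
  rw [IsBezout.iff_span_pair_isPrincipal]
  intro x y
  rcases htot x y with h | h
  · exact ⟨x, by rw [Ideal.submodule_span_eq, Ideal.span_pair_eq_span_left_iff_dvd.2 h]⟩
  · exact ⟨y, by rw [Ideal.submodule_span_eq, Ideal.span_pair_eq_span_right_iff_dvd.2 h]⟩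

/-- Flatness over a Bézout ring only needs to be tested on relations `a • x = 0`. -/
theorem Module.Flat.of_smul_eq_zero [IsBezout R] {E : Type u} [AddCommGroup E] [Module R E]
    (h : ∀ (a : R) (x : E), a • x = 0 → ∃ (b : R) (y : E), a * b = 0 ∧ b • y = x) :
    Module.Flat R E := by
  rw [Module.Flat.iff_lTensor_injective]
  intro I hI
  obtain ⟨a, rfl⟩ := (IsBezout.isPrincipal_of_FG I hI).principal
  have ha : a ∈ Submodule.span R {a} := Submodule.mem_span_singleton_self a
  have hpure : ∀ z : TensorProduct R E (Submodule.span R {a}), ∃ x : E, z = x ⊗ₜ ⟨a, ha⟩ := by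
    intro z
    induction z with
    | zero => exact ⟨0, (TensorProduct.zero_tmul _ _).symm⟩
    | add z w hz hw =>
      obtain ⟨x, rfl⟩ := hz
      obtain ⟨y, rfl⟩ := hw
      exact ⟨x + y, (TensorProduct.add_tmul _ _ _).symm⟩
    | tmul x i =>
      obtain ⟨i, hi⟩ := i
      obtain ⟨r, rfl⟩ := Submodule.mem_span_singleton.1 hi
      exact ⟨r • x, by rw [TensorProduct.smul_tmul]; rfl⟩
  rw [injective_iff_map_eq_zero]
  intro z hz
  obtain ⟨x, rfl⟩ := hpure z
  have hax : a • x = 0 := by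
    have := congrArg (TensorProduct.rid R E) hz
    simpa using this
  obtain ⟨b, y, hab, rfl⟩ := h a x hax
  rw [TensorProduct.smul_tmul]
  have : b • (⟨a, ha⟩ : Submodule.span R {a}) = 0 := Subtype.ext (by simp [mul_comm b a, hab])
  rw [this, TensorProduct.tmul_zero]

theorem mem_comap_span_singleton_iff {q r : R} :
    r ∈ (Ideal.span {algebraMap R (Localization (nonZeroDivisors R)) q}).comap
      (algebraMap R (Localization (nonZeroDivisors R))) ↔
      ∃ n ∈ nonZeroDivisors R, q ∣ n * r := by
  rw [Ideal.mem_comap, ← Set.image_singleton, ← Ideal.map_span,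
    IsLocalization.algebraMap_mem_map_algebraMap_iff (nonZeroDivisors R)]
  simp only [Ideal.mem_span_singleton]

theorem mem_zeroDivisorsSet_iff {r : R} :
    r ∈ zeroDivisorsSet R ↔ r ∉ nonZeroDivisors R := by
  rw [mem_nonZeroDivisors_iff_right]
  simp only [zeroDivisorsSet, Set.mem_ofPred_eq, not_forall, mul_comm r, exists_prop]
  exact exists_congr fun s => and_comm

variable {E : Type u} [AddCommGroup E] [Module R E]

/-- If `a • x = 0` but `x` lies in no `b E` with `a b = 0`, then the annihilator of `x` is the
saturation of `R a`. -/
theorem smul_eq_zero_imp_exists_dvd (htot : ∀ a b : R, a ∣ b ∨ b ∣ a) {a : R} {x : E}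
    (ha : a ≠ 0) (hax : ∀ b : R, a * b = 0 → ∃ d : R, d * b = 0 ∧ d • x ≠ 0)
    {r : R} (hr : r • x = 0) : ∃ n ∈ nonZeroDivisors R, a ∣ n * r := by
  rcases htot a r with h | ⟨c, rfl⟩
  · exact ⟨1, one_mem _, by simpa using h⟩
  by_cases hc : c ∈ nonZeroDivisors R
  · exact ⟨c, hc, by rw [mul_comm]⟩
  obtain ⟨t, ht, hct⟩ := mem_zeroDivisorsSet_iff.2 hc
  rcases htot t r with ⟨k, rfl⟩ | ⟨s, rfl⟩
  · exact absurd (by linear_combination k * hct) ha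
  obtain ⟨d, hd, hdx⟩ := hax s (by linear_combination hct)
  rcases htot r d with ⟨w, rfl⟩ | ⟨w, rfl⟩
  · exact absurd (by rw [mul_comm, mul_smul, hr, smul_zero]) hdx
  · exact absurd (by linear_combination w * hd) ht

/-- In a uniform module, the shape of the annihilator of `x` propagates to all nonzero elements. -/
theorem exists_smul_eq_zero_iff_dvd (htot : ∀ a b : R, a ∣ b ∨ b ∣ a)
    (hunif : IsUniformModule R E)
    (hreg : ∀ n ∈ nonZeroDivisors R, ∀ x : E, n • x = 0 → x = 0) {a : R} {x : E} (ha : a ≠ 0)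
    (hx : ∀ r : R, r • x = 0 ↔ ∃ n ∈ nonZeroDivisors R, a ∣ n * r)
    (hax : ∀ b : R, a * b = 0 → ∃ d : R, d * b = 0 ∧ d • x ≠ 0)
    {y : E} (hy : y ≠ 0) :
    ∃ q : R, q ≠ 0 ∧ q ∉ nonZeroDivisors R ∧
      ∀ d : R, d • y = 0 ↔ ∃ n ∈ nonZeroDivisors R, q ∣ n * d := by
  have hax0 : a • x = 0 := (hx a).2 ⟨1, one_mem _, by simp⟩
  have hx0 : x ≠ 0 := by
    rintro rfl
    obtain ⟨d, -, hd⟩ := hax 0 (mul_zero a)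
    exact hd (smul_zero d)
  obtain ⟨z, ⟨hzx, hzy⟩, hz⟩ := Submodule.exists_mem_ne_zero_of_ne_bot
    (hunif.2 (Submodule.span R {x}) (Submodule.span R {y}) (by simpa using hx0)
      (by simpa using hy))
  obtain ⟨r, rfl⟩ := Submodule.mem_span_singleton.1 hzx
  obtain ⟨s, hs⟩ := Submodule.mem_span_singleton.1 hzy
  rcases htot a r with ⟨k, rfl⟩ | ⟨c, rfl⟩
  · exact absurd (by rw [mul_comm, mul_smul, hax0, smul_zero]) hz
  have hsy : s • y ≠ 0 := hs ▸ hz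
  have hqy : (s * c) • y = 0 := by
    rw [mul_comm, mul_smul, hs, smul_smul, mul_comm, hax0]
  refine ⟨s * c, ?_, fun hq => hy (hreg _ hq y hqy), fun d => ⟨fun hd => ?_, ?_⟩⟩
  · intro hsc
    rcases htot r s with ⟨b, rfl⟩ | ⟨b, rfl⟩
    · obtain ⟨d, hd, hdx⟩ := hax b (by linear_combination hsc)
      rcases htot r d with ⟨w, rfl⟩ | ⟨w, rfl⟩
      · refine hdx ?_
        rw [mul_comm, mul_smul, ← hs, smul_smul, show w * (r * b) = 0 by linear_combination hd,
          zero_smul]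
      · refine hsy ?_
        rw [show d * w * b = 0 by linear_combination w * hd, zero_smul]
    · exact ha (by linear_combination b * hsc)
  · rcases htot d s with ⟨k, rfl⟩ | ⟨e, rfl⟩
    · exact absurd (by rw [mul_comm, mul_smul, hd, smul_zero]) hsy
    have her : (e * r) • x = 0 := by rw [mul_smul, ← hs, smul_smul, mul_comm, hd]
    obtain ⟨n, hn, t, ht⟩ := (hx _).1 her
    refine ⟨n, hn, ?_⟩
    rcases htot c (n * e - c * t) with ⟨k, hk⟩ | ⟨k, hk⟩
    · exact ⟨k + t, by linear_combination s * hk⟩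
    · exact absurd (by rw [hk]; linear_combination k * ht) ha
  · rintro ⟨n, hn, k, hk⟩
    refine hreg n hn _ ?_
    rw [smul_smul, hk, mul_comm, mul_smul, hqy, smul_zero]

/-- Every saturation of a nonzero principal ideal of zero-divisors is an annihilator as soon as
one is. -/
theorem exists_ne_zero_smul_eq_zero_iff_dvd [IsLocalRing R]
    (htot : ∀ a b : R, a ∣ b ∨ b ∣ a) (hinj : Module.Injective R E)
    (hreg : ∀ n ∈ nonZeroDivisors R, ∀ x : E, n • x = 0 → x = 0) {a : R} {x : E} (ha : a ≠ 0)
    (hx0 : x ≠ 0) (hx : ∀ r : R, r • x = 0 ↔ ∃ n ∈ nonZeroDivisors R, a ∣ n * r)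
    {q : R} (hq0 : q ≠ 0) (hq : q ∉ nonZeroDivisors R) :
    ∃ y : E, y ≠ 0 ∧ ∀ d : R, d • y = 0 ↔ ∃ n ∈ nonZeroDivisors R, q ∣ n * d := by
  have hax0 : a • x = 0 := (hx a).2 ⟨1, one_mem _, by simp⟩
  have hsat : ∀ y : E, q • y = 0 → ∀ d : R, (∃ n ∈ nonZeroDivisors R, q ∣ n * d) →
      d • y = 0 := by
    rintro y hqy d ⟨n, hn, k, hk⟩
    refine hreg n hn _ ?_
    rw [smul_smul, hk, mul_comm, mul_smul, hqy, smul_zero]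
  rcases htot a q with ⟨t, rfl⟩ | ⟨t, rfl⟩
  · obtain ⟨y, rfl⟩ := hinj.exists_smul_eq (b := t) (x := x) fun d hd => by
      rcases htot a d with ⟨k, rfl⟩ | ⟨k, rfl⟩
      · rw [mul_comm, mul_smul, hax0, smul_zero]
      · exact absurd (by linear_combination k * hd) hq0
    refine ⟨y, fun h => hx0 (by rw [h, smul_zero]),
      fun d => ⟨fun hd => ?_, hsat y (by rw [mul_smul, hax0]) d⟩⟩
    rcases htot d t with ⟨k, rfl⟩ | ⟨e, rfl⟩
    · exact absurd (by rw [mul_comm, mul_smul, hd, smul_zero]) hx0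
    obtain ⟨n, hn, k, hk⟩ := (hx e).1 (by rw [smul_smul, mul_comm, hd])
    exact ⟨n, hn, k, by linear_combination t * hk⟩
  · refine ⟨t • x, fun htx => ?_,
      fun d => ⟨fun hd => ?_, hsat _ (by rw [smul_smul, hax0]) d⟩⟩
    · obtain ⟨n, hn, k, hk⟩ := (hx t).1 htx
      rcases htot n q with ⟨m, rfl⟩ | ⟨m, rfl⟩
      · have hm : m ∉ nonZeroDivisors R := fun hm => hq (mul_mem hn hm)
        have h1 : (1 - m * k) * t = 0 := by
          refine (mem_nonZeroDivisors_iff_right.1 hn) _ ?_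
          linear_combination hk
        have hu : IsUnit (1 - m * k) := by
          refine (IsLocalRing.isUnit_or_isUnit_one_sub_self (m * k)).resolve_left fun h => ?_
          exact hm (isUnit_of_mul_isUnit_left h).mem_nonZeroDivisors
        have ht : t = 0 := (hu.mul_right_eq_zero).1 h1
        exact ha (by rw [ht, mul_zero])
      · exact hq ((mul_mem_nonZeroDivisors.1 hn).1)
    · obtain ⟨n, hn, k, hk⟩ := (hx (d * t)).1 (by rw [mul_smul, hd])
      refine ⟨n, hn, ?_⟩
      rcases htot q (n * d - q * k) with ⟨m, hm⟩ | ⟨m, hm⟩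
      · exact ⟨m + k, by linear_combination hm⟩
      · exact absurd (by rw [hm]; linear_combination m * hk) ha

end ChainRing

/-- over a chain ring `R` with set of zero-divisors `Z` and `Q = R_Z` (the
localization at the non-zero-divisors), an indecomposable injective module `E` with
`E_♯ ⊆ Z` is flat provided its set of annihilator ideals is not the set of contractions to `R`
of the principal ideals `qQ`, `0 ≠ q ∈ Z`. -/
theorem stmt11 (R : Type u) [CommRing R] [IsLocalRing R]
    (hchain : ∀ I J : Ideal R, I ≤ J ∨ J ≤ I)
    (E : Type u) [AddCommGroup E] [Module R E]
    (hinj : Module.Injective R E) (hind : IsIndecomposable R E)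
    (hsharp : sharpSet R E ⊆ zeroDivisorsSet R)
    (hann : {A : Ideal R | ∃ x : E, x ≠ 0 ∧ A = Ideal.torsionOf R E x} ≠
      {A : Ideal R | ∃ q : R, q ≠ 0 ∧ q ∈ zeroDivisorsSet R ∧
        A = (Ideal.span {algebraMap R (Localization (nonZeroDivisors R)) q}).comap
              (algebraMap R (Localization (nonZeroDivisors R)))}) :
    Module.Flat R E := by
  have htot := dvd_total_of_ideals hchain
  have hunif := hind.isUniformModule hinj
  have hreg : ∀ n ∈ nonZeroDivisors R, ∀ x : E, n • x = 0 → x = 0 := by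
    intro n hn x hx
    by_contra hx0
    exact mem_zeroDivisorsSet_iff.1 (hsharp ⟨x, hx0, hx⟩) hn
  have := isBezout_of_dvd_total htot
  refine Module.Flat.of_smul_eq_zero fun a x hax0 => ?_
  by_contra hno
  have hax : ∀ b : R, a * b = 0 → ∃ d : R, d * b = 0 ∧ d • x ≠ 0 := by
    intro b hab
    by_contra! hd
    obtain ⟨y, hy⟩ := hinj.exists_smul_eq hd
    exact hno ⟨b, y, hab, hy⟩
  have ha : a ≠ 0 := by
    rintro rfl
    exact hno ⟨1, x, zero_mul 1, one_smul R x⟩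
  have hx0 : x ≠ 0 := by
    rintro rfl
    exact hno ⟨0, 0, mul_zero a, smul_zero 0⟩
  have hx : ∀ r : R, r • x = 0 ↔ ∃ n ∈ nonZeroDivisors R, a ∣ n * r := by
    refine fun r => ⟨smul_eq_zero_imp_exists_dvd htot ha hax, ?_⟩
    rintro ⟨n, hn, k, hk⟩
    refine hreg n hn _ ?_
    rw [smul_smul, hk, mul_comm, mul_smul, hax0, smul_zero]
  refine hann (Set.ext fun A => ⟨?_, ?_⟩)
  · rintro ⟨y, hy, rfl⟩
    obtain ⟨q, hq0, hq, h⟩ := exists_smul_eq_zero_iff_dvd htot hunif hreg ha hx hax hy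
    refine ⟨q, hq0, mem_zeroDivisorsSet_iff.2 hq, Ideal.ext fun d => ?_⟩
    rw [Ideal.mem_torsionOf_iff, mem_comap_span_singleton_iff, h]
  · rintro ⟨q, hq0, hq, rfl⟩
    obtain ⟨y, hy, h⟩ := exists_ne_zero_smul_eq_zero_iff_dvd htot hinj hreg ha hx0 hx hq0
      (mem_zeroDivisorsSet_iff.1 hq)
    refine ⟨y, hy, Ideal.ext fun d => ?_⟩
    rw [Ideal.mem_torsionOf_iff, mem_comap_span_singleton_iff, h]
end

section
/- Let R be a chain ring with maximal ideal P and nilradical N, and suppose a pure-injective hull of R (as an R-module) has finite Malcev rank. Then there exists a finite descending chain of prime ideals P = L_0 ⊃ L_1 ⊃ … ⊃ L_{m−1} ⊃ L_m ⊇ N such that for each k with 0 ≤ k ≤ m−1 the chain ring (R/L_{k+1})_{L_k} (the localization of R/L_{k+1} at the prime L_k/L_{k+1}) is almost maximal, and R_{L_m} is maximal. -/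
open DirectSum


universe u v

section PureInjective

variable {R : Type u} [CommRing R] {H : Type u} [AddCommGroup H] [Module R H]

/-- If every finite part of a generating family of `N` is killed by a retraction of `f`, then
`f` followed by the projection modulo `N` is a pure embedding. -/
theorem pure_range_mkQ_comp {M : Type u} [AddCommGroup M] [Module R M] (f : H →ₗ[R] M)
    {J : Type u} (v : J → M) (N : Submodule R M) (hN : N = Submodule.span R (Set.range v))
    (hretr : ∀ s : Finset J, ∃ ρ : M →ₗ[R] H, (∀ j ∈ s, ρ (v j) = 0) ∧ ρ ∘ₗ f = LinearMap.id) :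
    Function.Injective (N.mkQ ∘ₗ f) ∧ IsPureSubmodule R (LinearMap.range (N.mkQ ∘ₗ f)) := by
  classical
  have key : ∀ x ∈ N, ∃ s : Finset J, ∀ ρ : M →ₗ[R] H,
      (∀ j ∈ s, ρ (v j) = 0) → ρ x = 0 := by
    intro x hx
    rw [hN] at hx
    induction hx using Submodule.span_induction with
    | mem x hx =>
      obtain ⟨j, rfl⟩ := hx
      exact ⟨{j}, fun ρ hρ => hρ j (by simp)⟩
    | zero => exact ⟨∅, fun ρ _ => map_zero ρ⟩
    | add x y _ _ hx hy =>
      obtain ⟨s, hs⟩ := hx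
      obtain ⟨t, ht⟩ := hy
      refine ⟨s ∪ t, fun ρ hρ => ?_⟩
      rw [map_add, hs ρ fun j hj => hρ j (by simp [hj]), ht ρ fun j hj => hρ j (by simp [hj]),
        add_zero]
    | smul a x _ hx =>
      obtain ⟨s, hs⟩ := hx
      exact ⟨s, fun ρ hρ => by rw [map_smul, hs ρ hρ, smul_zero]⟩
  have hi : Function.Injective (N.mkQ ∘ₗ f) := by
    rw [injective_iff_map_eq_zero]
    intro x hx
    have hxN : f x ∈ N := by simpa using hx
    obtain ⟨s, hs⟩ := key _ hxN
    obtain ⟨ρ, hρ, hid⟩ := hretr s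
    have := hs ρ hρ
    rwa [← LinearMap.comp_apply, hid] at this
  refine ⟨hi, ?_⟩
  intro C _ _
  have hkey : ∀ w : TensorProduct R N C, ∃ s : Finset J, ∀ ρ : M →ₗ[R] H,
      (∀ j ∈ s, ρ (v j) = 0) → ρ.rTensor C (N.subtype.rTensor C w) = 0 := by
    intro w
    induction w using TensorProduct.induction_on with
    | zero => exact ⟨∅, fun ρ _ => by simp⟩
    | tmul x c =>
      obtain ⟨s, hs⟩ := key x.1 x.2
      exact ⟨s, fun ρ hρ => by simp [hs ρ hρ]⟩
    | add x y hx hy =>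
      obtain ⟨s, hs⟩ := hx
      obtain ⟨t, ht⟩ := hy
      refine ⟨s ∪ t, fun ρ hρ => ?_⟩
      rw [map_add, map_add, hs ρ fun j hj => hρ j (by simp [hj]),
        ht ρ fun j hj => hρ j (by simp [hj]), add_zero]
  have hinj : Function.Injective ((N.mkQ ∘ₗ f).rTensor C) := by
    rw [injective_iff_map_eq_zero]
    intro t ht
    have h0 : N.mkQ.rTensor C (f.rTensor C t) = 0 := by
      rw [← LinearMap.comp_apply, ← LinearMap.rTensor_comp]; exact ht
    obtain ⟨w, hw⟩ := (rTensor_exact C (LinearMap.exact_subtype_mkQ N)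
      N.mkQ_surjective _).1 h0
    obtain ⟨s, hs⟩ := hkey w
    obtain ⟨ρ, hρ, hid⟩ := hretr s
    have h1 := hs ρ hρ
    rw [hw, ← LinearMap.comp_apply, ← LinearMap.rTensor_comp, hid, LinearMap.rTensor_id] at h1
    exact h1
  have hcomp : (LinearMap.range (N.mkQ ∘ₗ f)).subtype.rTensor C ∘ₗ
      (N.mkQ ∘ₗ f).rangeRestrict.rTensor C = (N.mkQ ∘ₗ f).rTensor C := by
    rw [← LinearMap.rTensor_comp]; rfl
  have hsurj : Function.Surjective ((N.mkQ ∘ₗ f).rangeRestrict.rTensor C) :=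
    LinearMap.rTensor_surjective C (LinearMap.surjective_rangeRestrict _)
  intro a b hab
  obtain ⟨a, rfl⟩ := hsurj a
  obtain ⟨b, rfl⟩ := hsurj b
  rw [← LinearMap.comp_apply, ← LinearMap.comp_apply, hcomp] at hab
  rw [hinj hab]

/-- A pure-injective module is algebraically compact. -/
theorem IsPureInjective.exists_solution (hpi : IsPureInjective R H) {J K : Type u}
    (E : J → K →₀ R) (h : J → H)
    (hfin : ∀ s : Finset J, ∃ y : K → H, ∀ j ∈ s, Finsupp.linearCombination R y (E j) = h j) :
    ∃ y : K → H, ∀ j, Finsupp.linearCombination R y (E j) = h j := by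
  let N : Submodule R (H × (K →₀ R)) := Submodule.span R (Set.range fun j => (-(h j), E j))
  obtain ⟨hi, hpure⟩ := pure_range_mkQ_comp (LinearMap.inl R H (K →₀ R))
    (fun j => (-(h j), E j)) N rfl (by
      intro s
      obtain ⟨y, hy⟩ := hfin s
      refine ⟨LinearMap.coprod LinearMap.id (Finsupp.linearCombination R y), fun j hj => ?_, ?_⟩
      · simp [hy j hj]
      · exact LinearMap.coprod_inl _ _)
  obtain ⟨g, hg⟩ := hpi _ _ hpure
    ((LinearEquiv.ofInjective _ hi).symm : _ →ₗ[R] H)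
  have hgi : ∀ x, g (N.mkQ (LinearMap.inl R H (K →₀ R) x)) = x := fun x =>
    (hg (LinearEquiv.ofInjective _ hi x)).trans ((LinearEquiv.ofInjective _ hi).symm_apply_apply x)
  let gq : (K →₀ R) →ₗ[R] H := g ∘ₗ N.mkQ ∘ₗ LinearMap.inr R H (K →₀ R)
  refine ⟨fun k => gq (Finsupp.single k 1), fun j => ?_⟩
  have h1 : Finsupp.linearCombination R (fun k => gq (Finsupp.single k 1)) = gq := by
    ext k; simp
  rw [h1, ← hgi (h j)]
  change g (N.mkQ _) = g (N.mkQ _)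
  congr 1
  rw [← sub_eq_zero, ← map_sub, Submodule.mkQ_apply, Submodule.Quotient.mk_eq_zero]
  refine Submodule.subset_span ⟨j, ?_⟩
  simp

theorem dvd_of_smul_eq_smul {ι : R →ₗ[R] H} (hι : Function.Injective ι)
    (hp : IsPureSubmodule R (LinearMap.range ι)) {c r : R} {h : H}
    (hc : c • ι 1 = r • h) : r ∣ c := by
  let I : Ideal R := Ideal.span {r}
  have hinj : Function.Injective (ι.rTensor (R ⧸ I)) := by
    let e : R ≃ₗ[R] LinearMap.range ι := LinearEquiv.ofInjective ι hι
    have hcomp : (LinearMap.range ι).subtype.rTensor (R ⧸ I) ∘ₗ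
        (e : R →ₗ[R] _).rTensor (R ⧸ I) = ι.rTensor (R ⧸ I) := by
      rw [← LinearMap.rTensor_comp]; rfl
    rw [← hcomp, LinearMap.coe_comp]
    exact (hp (R ⧸ I)).comp (e.rTensor (R ⧸ I)).injective
  have h0 : ι.rTensor (R ⧸ I) (c ⊗ₜ[R] (Ideal.Quotient.mk I 1)) = 0 := by
    rw [LinearMap.rTensor_tmul, show ι c = r • h by rw [← hc, ← map_smul, smul_eq_mul, mul_one],
      TensorProduct.smul_tmul]
    have : r • (Ideal.Quotient.mk I 1) = 0 := by
      rw [← Ideal.Quotient.mkₐ_eq_mk R, ← map_smul, Ideal.Quotient.mkₐ_eq_mk,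
        Ideal.Quotient.eq_zero_iff_mem]
      rw [smul_eq_mul, mul_one]; exact Ideal.mem_span_singleton_self r
    rw [this, TensorProduct.tmul_zero]
  have h1 := hinj (h0.trans (map_zero _).symm)
  have h2 : TensorProduct.lid R (R ⧸ I) (c ⊗ₜ[R] (Ideal.Quotient.mk I 1)) = 0 := by
    rw [h1, map_zero]
  rw [TensorProduct.lid_tmul, ← Ideal.Quotient.mkₐ_eq_mk R, ← map_smul, Ideal.Quotient.mkₐ_eq_mk,
    Ideal.Quotient.eq_zero_iff_mem, smul_eq_mul, mul_one] at h2
  exact Ideal.mem_span_singleton.1 h2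

end PureInjective

section Compact

variable {R : Type u} [CommRing R] {H : Type u} [AddCommGroup H] [Module R H]

theorem exists_finite_recursive_solution (n : ℕ) : ∀ (g : ℕ → H) (Q : ℕ → R),
    ∃ y : ℕ → H, ∀ i < n, y i = g i + Q i • y (i + 1) := by
  induction n with
  | zero => exact fun _ _ => ⟨0, fun i hi => absurd hi (Nat.not_lt_zero i)⟩
  | succ n ih =>
    intro g Q
    obtain ⟨y, hy⟩ := ih (fun i => g (i + 1)) (fun i => Q (i + 1))
    refine ⟨fun i => Nat.casesOn i (g 0 + Q 0 • y 0) y, fun i hi => ?_⟩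
    cases i with
    | zero => rfl
    | succ i => exact hy i (by omega)

theorem IsPureInjective.exists_recursive_solution (hpi : IsPureInjective R H)
    (g : ℕ → H) (Q : ℕ → R) : ∃ y : ℕ → H, ∀ i, y i = g i + Q i • y (i + 1) := by
  obtain ⟨y, hy⟩ := hpi.exists_solution (J := ULift.{u} ℕ) (K := ULift.{u} ℕ)
    (fun i => Finsupp.single i 1 - Finsupp.single ⟨i.down + 1⟩ (Q i.down)) (fun i => g i.down) (by
      intro s
      obtain ⟨y, hy⟩ := exists_finite_recursive_solution (s.sup ULift.down + 1) g Q
      refine ⟨fun i => y i.down, fun j hj => ?_⟩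
      have := hy j.down (Nat.lt_succ_of_le (Finset.le_sup (f := ULift.down) hj))
      simp [this])
  refine ⟨fun i => y ⟨i⟩, fun i => ?_⟩
  have := hy ⟨i⟩
  simp only [map_sub, Finsupp.linearCombination_single, one_smul] at this
  rw [← this]; abel

theorem exists_dvd_top_of_finset (hd : ∀ a b : R, a ∣ b ∨ b ∣ a) {J : Type v} (σ : J → R)
    (s : Finset J) (hs : s.Nonempty) : ∃ i ∈ s, ∀ j ∈ s, σ j ∣ σ i := by
  classical
  induction hs using Finset.Nonempty.cons_induction with
  | singleton a => exact ⟨a, by simp, by simp⟩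
  | cons a s ha hs ih =>
    obtain ⟨i, hi, h⟩ := ih
    rcases hd (σ a) (σ i) with h1 | h1
    · refine ⟨i, by simp [hi], fun j hj => ?_⟩
      rcases Finset.mem_cons.1 hj with rfl | hj
      · exact h1
      · exact h j hj
    · refine ⟨a, by simp, fun j hj => ?_⟩
      rcases Finset.mem_cons.1 hj with rfl | hj
      · exact dvd_rfl
      · exact (h j hj).trans h1

theorem IsPureInjective.exists_pseudo_limit (hpi : IsPureInjective R H)
    (hd : ∀ a b : R, a ∣ b ∨ b ∣ a) {J : Type u} (σ : J → R) (h : J → H)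
    (hc : ∀ j j', σ j ∣ σ j' → ∃ w, h j' - h j = σ j • w) :
    ∃ z, ∀ j, ∃ w, z - h j = σ j • w := by
  classical
  obtain ⟨y, hy⟩ := hpi.exists_solution (J := J) (K := Option J)
    (fun j => Finsupp.single none 1 - Finsupp.single (some j) (σ j)) h (by
      intro s
      rcases s.eq_empty_or_nonempty with rfl | hs
      · exact ⟨0, by simp⟩
      · obtain ⟨i, hi, hdiv⟩ := exists_dvd_top_of_finset hd σ s hs
        have : ∀ j : J, ∃ w, j ∈ s → h i - h j = σ j • w := fun j => by
          by_cases hj : j ∈ s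
          · obtain ⟨w, hw⟩ := hc j i (hdiv j hj)
            exact ⟨w, fun _ => hw⟩
          · exact ⟨0, fun h => absurd h hj⟩
        choose w hw using this
        refine ⟨fun k => k.elim (h i) w, fun j hj => ?_⟩
        simp [← hw j hj])
  refine ⟨y none, fun j => ⟨y (some j), ?_⟩⟩
  have := hy j
  simp only [map_sub, Finsupp.linearCombination_single, one_smul] at this
  rw [← this]; abel

theorem MalcevRankLE.le_of_minimal [IsLocalRing R] {n k : ℕ} (hn : MalcevRankLE R H n)
    (x : Fin k → H) (hx : ∀ c : Fin k → R, ∑ i, c i • x i = 0 → ∀ i, ¬IsUnit (c i)) :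
    k ≤ n := by
  classical
  obtain ⟨s, hsX, hsn, hspan⟩ := hn (Submodule.span R (Set.range x))
    ⟨Finset.univ.image x, by simp⟩
  have h1 : ∀ i, ∃ c : s → R, ∑ g, c g • (g : H) = x i := fun i => by
    rw [← Submodule.mem_span_range_iff_exists_fun R, Subtype.range_coe, hspan]
    exact Submodule.subset_span ⟨i, rfl⟩
  have h2 : ∀ g : s, ∃ c : Fin k → R, ∑ i, c i • x i = g := fun g => by
    rw [← Submodule.mem_span_range_iff_exists_fun R]
    exact hsX g.2
  choose B hB using h1
  choose D hD using h2
  let B' : Matrix (Fin k) s R := B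
  let D' : Matrix s (Fin k) R := D
  have h3 : ∀ i, ∑ j, ((B' * D') i j - (1 : Matrix (Fin k) (Fin k) R) i j) • x j = 0 := by
    intro i
    simp only [sub_smul, Finset.sum_sub_distrib, Matrix.mul_apply, Matrix.one_apply, ite_smul,
      one_smul, zero_smul, Finset.sum_ite_eq, Finset.mem_univ, if_true, Finset.sum_smul]
    rw [Finset.sum_comm, sub_eq_zero]
    calc _ = ∑ g, B i g • ∑ j, D g j • x j :=
          Finset.sum_congr rfl fun g _ => by
            rw [Finset.smul_sum]
            exact Finset.sum_congr rfl fun j _ => mul_smul _ _ _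
      _ = _ := by rw [← hB i]; exact Finset.sum_congr rfl fun g _ => by rw [hD g]
  let f := IsLocalRing.residue R
  have h4 : B'.map f * D'.map f = 1 := by
    rw [← Matrix.map_mul]
    ext i j
    have h5 := hx _ (h3 i) j
    have h6 : f ((B' * D') i j - (1 : Matrix (Fin k) (Fin k) R) i j) = 0 :=
      (IsLocalRing.residue_eq_zero_iff _).2 ((IsLocalRing.mem_maximalIdeal _).2 h5)
    rw [map_sub, sub_eq_zero] at h6
    rw [Matrix.map_apply, h6]
    by_cases hij : i = j <;> simp [Matrix.one_apply, hij]
  have h7 := Matrix.rank_mul_le_left (B'.map f) (D'.map f)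
  rw [h4, Matrix.rank_one, Fintype.card_fin] at h7
  have h8 := (B'.map f).rank_le_card_width
  rw [Fintype.card_coe] at h8
  omega

end Compact

section Arch

/-- The properties of a pure-injective hull of a chain ring that the argument uses: `x₀` generates
a pure copy of the ring, the module is algebraically compact, and its rank is at most `n`. -/
structure IsCompactOver (R : Type u) [CommRing R] (H : Type u) [AddCommGroup H] [Module R H]
    (x₀ : H) (n : ℕ) : Prop where
  total : ∀ a b : R, a ∣ b ∨ b ∣ a
  pure : ∀ (c r : R) (h : H), c • x₀ = r • h → r ∣ c
  recursive : ∀ (g : ℕ → H) (Q : ℕ → R), ∃ y : ℕ → H, ∀ i, y i = g i + Q i • y (i + 1)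
  limit : ∀ {J : Type u} (σ : J → R) (h : J → H),
    (∀ j j', σ j ∣ σ j' → ∃ w, h j' - h j = σ j • w) → ∃ z, ∀ j, ∃ w, z - h j = σ j • w
  rank : ∀ (k : ℕ) (x : Fin k → H),
    (∀ c : Fin k → R, ∑ i, c i • x i = 0 → ∀ i, ¬IsUnit (c i)) → k ≤ n

variable {R : Type u} [CommRing R] {H : Type u} [AddCommGroup H] [Module R H]

/-- The product of `m` consecutive terms of `p`, starting at index `i`. -/
def tailProd (p : ℕ → R) (i m : ℕ) : R := ∏ l ∈ Finset.range m, p (i + l)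

@[simp] theorem tailProd_zero (p : ℕ → R) (i : ℕ) : tailProd p i 0 = 1 := by simp [tailProd]

theorem tailProd_succ (p : ℕ → R) (i m : ℕ) :
    tailProd p i (m + 1) = tailProd p i m * p (i + m) := Finset.prod_range_succ _ _

theorem tailProd_add (p : ℕ → R) (i m t : ℕ) :
    tailProd p i (m + t) = tailProd p i m * tailProd p (i + m) t := by
  simp [tailProd, Finset.prod_range_add, add_assoc]

/-- The tail products of `p` are eventually divisors of any given element of `J`. -/
def TailDvd (J : Ideal R) (p : ℕ → R) : Prop := ∀ s ∈ J, ∃ j, ∀ m, tailProd p j m ∣ s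

theorem tailProd_dvd_of_le {p : ℕ → R} {s : R} {j i : ℕ} (h : ∀ m, tailProd p j m ∣ s)
    (hji : j ≤ i) (m : ℕ) : tailProd p i m ∣ s := by
  obtain ⟨t, rfl⟩ := Nat.exists_eq_add_of_le hji
  exact (Dvd.intro_left _ (tailProd_add p j t m).symm).trans (h _)

/-- A submodule carrying a system of congruences without solution, together with `k + 1`
elements that are independent modulo a power of `a`. -/
structure BadStage (H : Type u) [AddCommGroup H] [Module R H] (J : Ideal R) (a : R)
    (k l e b : ℕ) where
  F : Submodule R H
  Q : ℕ → R
  σ : ℕ → R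
  x : Fin (k + 1) → H
  g : ℕ → H
  tail : TailDvd J Q
  σ_succ : ∀ i, σ (i + 1) = σ i * Q i
  σ_dvd : ∀ i, σ i ∣ a ^ (k + 1)
  x_mem : ∀ i, x i ∈ F
  g_mem : ∀ i, g i ∈ F
  bad : ∀ f ∈ F, ∃ i, ∀ w ∈ F, f - ∑ j ∈ Finset.range i, σ j • g j ≠ σ i • w
  pure : ∀ r, r ∣ a ^ e → ∀ h, r • h ∈ F → ∃ f ∈ F, r • h = r • f
  torsion : ∀ f ∈ F, a ^ e • f = 0 → ∃ w ∈ F, f = a ^ l • w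
  indep : ∀ (c : Fin (k + 1) → R) (h : H), ∑ i, c i • x i = a ^ b • h → ∀ i, ¬IsUnit (c i)

namespace BadStage

variable {J : Ideal R} {a : R} {k l e b : ℕ} (S : BadStage H J a k l e b)

theorem σ_add (i t : ℕ) : S.σ (i + t) = S.σ i * tailProd S.Q i t := by
  induction t with
  | zero => simp
  | succ t ih => rw [← add_assoc, S.σ_succ, ih, tailProd_succ, mul_assoc]

theorem tailProd_dvd (i t : ℕ) : tailProd S.Q i t ∣ a ^ (k + 1) :=
  (Dvd.intro_left _ (S.σ_add i t).symm).trans (S.σ_dvd _)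

theorem sum_sub_mem (i t : ℕ) : ∃ w ∈ S.F,
    ∑ j ∈ Finset.range (i + t), S.σ j • S.g j - ∑ j ∈ Finset.range i, S.σ j • S.g j
      = S.σ i • w := by
  induction t with
  | zero => exact ⟨0, S.F.zero_mem, by simp⟩
  | succ t ih =>
    obtain ⟨w, hw, h⟩ := ih
    refine ⟨w + tailProd S.Q i t • S.g (i + t), S.F.add_mem hw (S.F.smul_mem _ (S.g_mem _)), ?_⟩
    rw [← add_assoc, Finset.sum_range_succ, S.σ_add i t, smul_add, ← h, mul_smul]
    abel

/-- A system unsolvable in `F` is also unsolvable from any index on. -/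
theorem bad_from (i : ℕ) (f : H) (hf : f ∈ S.F) : ∃ m, ∀ w ∈ S.F,
    f - ∑ j ∈ Finset.range (i + m), S.σ j • S.g j ≠ S.σ (i + m) • w := by
  by_contra! hcon
  obtain ⟨m, hm⟩ := S.bad f hf
  rcases le_total i m with h | h
  · obtain ⟨t, rfl⟩ := Nat.exists_eq_add_of_le h
    obtain ⟨w, hw, h1⟩ := hcon t
    exact hm w hw h1
  · obtain ⟨t, rfl⟩ := Nat.exists_eq_add_of_le h
    obtain ⟨w, hw, h1⟩ := hcon 0
    obtain ⟨w', hw', h2⟩ := S.sum_sub_mem m t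
    refine hm (w' + tailProd S.Q m t • w) (S.F.add_mem hw' (S.F.smul_mem _ hw)) ?_
    rw [add_zero, S.σ_add] at h1
    rw [smul_add, ← mul_smul, ← h1, ← h2]
    abel

variable {S} {y : ℕ → H}

theorem sum_add_smul (hy : ∀ i, y i = S.g i + S.Q i • y (i + 1)) (i : ℕ) :
    ∑ j ∈ Finset.range i, S.σ j • S.g j + S.σ i • y i = S.σ 0 • y 0 := by
  induction i with
  | zero => simp
  | succ i ih =>
    rw [← ih, Finset.sum_range_succ, S.σ_succ, hy i, smul_add, mul_smul, add_assoc]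

theorem exists_eq_add_smul (hy : ∀ i, y i = S.g i + S.Q i • y (i + 1)) (i t : ℕ) :
    ∃ f ∈ S.F, y i = f + tailProd S.Q i t • y (i + t) := by
  induction t with
  | zero => exact ⟨0, S.F.zero_mem, by simp⟩
  | succ t ih =>
    obtain ⟨f, hf, h⟩ := ih
    refine ⟨f + tailProd S.Q i t • S.g (i + t),
      S.F.add_mem hf (S.F.smul_mem _ (S.g_mem _)), ?_⟩
    rw [tailProd_succ, mul_smul, add_assoc, ← smul_add, ← add_assoc i, ← hy, ← h]

theorem not_smul_eq (hy : ∀ i, y i = S.g i + S.Q i • y (i + 1)) (hkl : k + 1 ≤ l)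
    (hle : l ≤ e) {i : ℕ} {c p : R} {f h : H} (hc : c ∣ a ^ (e - l)) (hf : f ∈ S.F)
    (hp : ∀ m, tailProd S.Q i m ∣ p) : c • y i ≠ c • f + (c * p) • h := by
  intro heq
  have hσl : ∀ m, S.σ m ∣ a ^ l := fun m => (S.σ_dvd m).trans (pow_dvd_pow a hkl)
  have hsum : ∀ m, ∑ j ∈ Finset.range m, S.σ j • S.g j ∈ S.F := fun m =>
    S.F.sum_mem fun j _ => S.F.smul_mem _ (S.g_mem j)
  have hf'' : ∑ j ∈ Finset.range i, S.σ j • S.g j + S.σ i • f ∈ S.F :=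
    S.F.add_mem (hsum i) (S.F.smul_mem _ hf)
  obtain ⟨m, hm⟩ := S.bad_from i _ hf''
  obtain ⟨q, rfl⟩ := hp m
  have h1 := sum_add_smul hy i
  have h2 := sum_add_smul hy (i + m)
  set A := ∑ j ∈ Finset.range i, S.σ j • S.g j
  set B := ∑ j ∈ Finset.range (i + m), S.σ j • S.g j
  have h3 : c • (A + S.σ i • f - B) = (c * S.σ (i + m)) • (y (i + m) - q • h) := by
    have h4 : S.σ i • c • y i = S.σ i • (c • f + (c * (tailProd S.Q i m * q)) • h) := by rw [heq]
    have h5 : A - B = S.σ (i + m) • y (i + m) - S.σ i • y i := by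
      rw [sub_eq_sub_iff_add_eq_add, h1, add_comm, h2]
    have h6 : A + S.σ i • f - B = (A - B) + S.σ i • f := by abel
    rw [h6, h5, S.σ_add]
    have h7 : c • (S.σ i * tailProd S.Q i m) • y (i + m) - S.σ i • c • y i + S.σ i • c • f
        = (c * (S.σ i * tailProd S.Q i m)) • (y (i + m) - q • h) := by
      rw [h4]; module
    rw [← h7]; module
  obtain ⟨w, hw, h4⟩ := S.pure (c * S.σ (i + m)) (by
      calc c * S.σ (i + m) ∣ a ^ (e - l) * a ^ l := mul_dvd_mul hc (hσl _)
        _ = a ^ e := by rw [← pow_add, Nat.sub_add_cancel hle])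
    _ (h3 ▸ S.F.smul_mem c (S.F.sub_mem hf'' (hsum _)))
  rw [h4, mul_smul, ← sub_eq_zero, ← smul_sub] at h3
  obtain ⟨d, hd⟩ := hc.trans (pow_dvd_pow a (Nat.sub_le e l))
  obtain ⟨w', hw', h5⟩ := S.torsion _
    (S.F.sub_mem (S.F.sub_mem hf'' (hsum _)) (S.F.smul_mem _ hw))
    (by rw [hd, mul_comm, mul_smul, h3, smul_zero])
  obtain ⟨d', hd'⟩ := hσl (i + m)
  refine hm (w + d' • w') (S.F.add_mem hw (S.F.smul_mem _ hw')) ?_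
  rw [smul_add, ← mul_smul, ← hd', ← h5]
  abel

variable {x₀ : H} {n : ℕ} (hD : IsCompactOver R H x₀ n)

include hD in
theorem pow_dvd_of_smul_mem (hy : ∀ i, y i = S.g i + S.Q i • y (i + 1)) (hkl : k + 1 ≤ l)
    (hle : l ≤ e) {i : ℕ} {c : R} (hc : c • y i ∈ S.F) : a ^ (e - l) ∣ c := by
  refine (hD.total _ _).resolve_right fun h => ?_
  obtain ⟨f, hf, h1⟩ := S.pure c (h.trans (pow_dvd_pow a (Nat.sub_le e l))) _ hc
  exact not_smul_eq (h := 0) (p := 0) hy hkl hle h hf (fun m => dvd_zero _) (by simpa using h1)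

/-- The submodule generated by `F` and a sequence of partial solutions. -/
def ext (S : BadStage H J a k l e b) {y : ℕ → H}
    (hy : ∀ i, y i = S.g i + S.Q i • y (i + 1)) : Submodule R H where
  carrier := {v | ∃ m, ∃ f ∈ S.F, ∃ c : R, v = f + c • y m}
  zero_mem' := ⟨0, 0, S.F.zero_mem, 0, by simp⟩
  smul_mem' := by
    rintro r _ ⟨m, f, hf, c, rfl⟩
    exact ⟨m, r • f, S.F.smul_mem _ hf, r * c, by rw [smul_add, mul_smul]⟩
  add_mem' := by
    rintro _ _ ⟨m, f, hf, c, rfl⟩ ⟨m', f', hf', c', rfl⟩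
    obtain ⟨f1, hf1, h1⟩ := exists_eq_add_smul hy m m'
    obtain ⟨f2, hf2, h2⟩ := exists_eq_add_smul hy m' m
    refine ⟨m + m', f + c • f1 + (f' + c' • f2), S.F.add_mem
      (S.F.add_mem hf (S.F.smul_mem _ hf1)) (S.F.add_mem hf' (S.F.smul_mem _ hf2)),
      c * tailProd S.Q m m' + c' * tailProd S.Q m' m, ?_⟩
    rw [add_comm m' m] at h2
    rw [h1, h2]
    module

theorem le_ext (hy : ∀ i, y i = S.g i + S.Q i • y (i + 1)) {f : H} (hf : f ∈ S.F) :
    f ∈ S.ext hy := ⟨0, f, hf, 0, by simp⟩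

theorem mem_ext (hy : ∀ i, y i = S.g i + S.Q i • y (i + 1)) (m : ℕ) : y m ∈ S.ext hy :=
  ⟨m, 0, S.F.zero_mem, 1, by simp⟩

theorem smul_add_mem (hy : ∀ i, y i = S.g i + S.Q i • y (i + 1)) {f : H} (hf : f ∈ S.F)
    (c : R) (m : ℕ) : f + c • y m ∈ S.ext hy :=
  (S.ext hy).add_mem (le_ext hy hf) ((S.ext hy).smul_mem _ (mem_ext hy m))

include hD in
theorem ext_pure (hy : ∀ i, y i = S.g i + S.Q i • y (i + 1)) (hkl : k + 1 ≤ l)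
    (hle : l ≤ e) {r : R} (hr : r ∣ a ^ (e - l)) (h : H) (hrh : r • h ∈ S.ext hy) :
    ∃ v ∈ S.ext hy, r • h = r • v := by
  have easy : ∀ f ∈ S.F, ∀ (d : R) (i : ℕ), r • h = f + (r * d) • y i →
      ∃ v ∈ S.ext hy, r • h = r • v := by
    intro f hf d i h1
    have h2 : r • (h - d • y i) = f := by rw [smul_sub, h1, mul_smul]; abel
    obtain ⟨f1, hf1, h3⟩ := S.pure r (hr.trans (pow_dvd_pow a (Nat.sub_le e l)))
      (h - d • y i) (h2 ▸ hf)
    refine ⟨f1 + d • y i, smul_add_mem hy hf1 d i, ?_⟩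
    rw [smul_add, ← h3, smul_sub]; abel
  obtain ⟨i, f, hf, c, h1⟩ := hrh
  rcases hD.total r c with ⟨d, rfl⟩ | ⟨p, rfl⟩
  · exact easy f hf d i h1
  · by_cases hp : ∀ m, tailProd S.Q i m ∣ p
    · have h2 : c • (p • h - y i) = f := by rw [smul_sub, ← mul_smul, h1]; abel
      have hc : c ∣ a ^ (e - l) := (Dvd.intro _ rfl).trans hr
      obtain ⟨f1, hf1, h3⟩ := S.pure c (hc.trans (pow_dvd_pow a (Nat.sub_le e l)))
        _ (h2 ▸ hf)
      exact absurd (show c • y i = c • (-f1) + (c * p) • h by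
        rw [h1, ← h2, h3]; rw [h2] at h3; simp) (not_smul_eq hy hkl hle hc (S.F.neg_mem hf1) hp)
    · push Not at hp
      obtain ⟨m, hm⟩ := hp
      obtain ⟨q, hq⟩ := (hD.total _ _).resolve_left hm
      obtain ⟨f2, hf2, h2⟩ := exists_eq_add_smul hy i m
      refine easy (f + c • f2) (S.F.add_mem hf (S.F.smul_mem _ hf2)) q (i + m) ?_
      rw [h1, h2, hq]; module

include hD in
theorem ext_torsion [IsLocalRing R] (hy : ∀ i, y i = S.g i + S.Q i • y (i + 1))
    (hkl : k + 1 ≤ l) {e2 : ℕ} (hle : e = e2 + 2 * l) (ha : a ^ (e2 + l) ≠ 0) {v : H}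
    (hv : v ∈ S.ext hy) (hav : a ^ e2 • v = 0) : ∃ w ∈ S.ext hy, v = a ^ l • w := by
  obtain ⟨i, f, hf, d, rfl⟩ := hv
  have h1 : (a ^ e2 * d) • y i = -(a ^ e2 • f) := by
    rw [mul_smul, eq_neg_iff_add_eq_zero, add_comm, ← smul_add, hav]
  have h2 : a ^ (e - l) ∣ a ^ e2 * d := pow_dvd_of_smul_mem hD hy hkl (by omega)
    (h1 ▸ S.F.neg_mem (S.F.smul_mem _ hf))
  rw [show e - l = e2 + l by omega] at h2
  have h3 : a ^ l ∣ d := by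
    by_contra hn
    obtain ⟨u, hu⟩ := (hD.total _ _).resolve_left hn
    have hun : ¬IsUnit u := fun hun => hn (by
      rw [hu]; exact (hun.mul_right_dvd).2 dvd_rfl)
    obtain ⟨w, hw⟩ := h2
    have h4 : IsUnit (1 - u * w) :=
      (IsLocalRing.isUnit_or_isUnit_one_sub_self (u * w)).resolve_left
        fun h => hun (isUnit_of_mul_isUnit_left h)
    have h5 : (a ^ e2 * d) * (1 - u * w) = 0 := by
      rw [pow_add, hu] at hw; linear_combination hw
    have h6 := h4.mul_left_eq_zero.1 h5
    exact ha (by rw [pow_add, hu, ← mul_assoc, h6, zero_mul])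
  obtain ⟨d', rfl⟩ := h3
  have h4 : a ^ e2 • f = a ^ (e2 + l) • (-(d' • y i)) := by
    rw [← neg_neg (a ^ e2 • f), ← h1, pow_add]; module
  obtain ⟨f1, hf1, h5⟩ := S.pure (a ^ (e2 + l)) (pow_dvd_pow a (by omega)) _
    (h4 ▸ S.F.smul_mem _ hf)
  have h6 : a ^ e2 • (f - a ^ l • f1) = 0 := by
    rw [smul_sub, h4, h5, pow_add, mul_smul, sub_self]
  obtain ⟨f2, hf2, h7⟩ := S.torsion _ (S.F.sub_mem hf (S.F.smul_mem (a ^ l) hf1)) (by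
    rw [hle, pow_add, mul_comm, mul_smul, h6, smul_zero])
  refine ⟨f1 + f2 + d' • y i, smul_add_mem hy (S.F.add_mem hf1 hf2) _ _, ?_⟩
  rw [smul_add, smul_add, ← h7, mul_smul]; abel

include hD in
theorem snoc_indep (ha : ¬IsUnit a) (hy : ∀ i, y i = S.g i + S.Q i • y (i + 1))
    (hkl : k + 1 ≤ l) (hle : l ≤ e) (hb : b ≤ e - l) (hb0 : b ≠ 0) (c : Fin (k + 2) → R) (h : H)
    (hc : ∑ i, c i • (Fin.snoc S.x (y 0) : Fin (k + 2) → H) i = a ^ (b + l) • h) :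
    ∀ i, ¬IsUnit (c i) := by
  rw [Fin.sum_univ_castSucc] at hc
  simp only [Fin.snoc_castSucc, Fin.snoc_last] at hc
  have hX : ∑ i : Fin (k + 1), c i.castSucc • S.x i ∈ S.F :=
    S.F.sum_mem fun i _ => S.F.smul_mem _ (S.x_mem i)
  have h1 : a ^ b ∣ c (Fin.last _) := by
    refine (hD.total _ _).resolve_right ?_
    rintro ⟨u, hu⟩
    have hca : c (Fin.last _) ∣ a ^ b := ⟨u, hu⟩
    set d := c (Fin.last (k + 1))
    set X := ∑ i : Fin (k + 1), c i.castSucc • S.x i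
    have h2 : d • ((u * a ^ l) • h - y 0) = X := by
      rw [smul_sub, ← mul_smul, ← mul_assoc, ← hu, ← pow_add, ← hc]; abel
    obtain ⟨f, hf, h3⟩ := S.pure d (hca.trans (pow_dvd_pow a (hb.trans (Nat.sub_le e l)))) _
      (h2 ▸ hX)
    refine not_smul_eq hy hkl hle (f := -f) (h := h) (p := u * a ^ l) (i := 0)
      (hca.trans (pow_dvd_pow a hb)) (S.F.neg_mem hf) (fun m => ?_) ?_
    · exact ((S.tailProd_dvd 0 m).trans (pow_dvd_pow a hkl)).mul_left u
    · rw [smul_neg, ← h3, smul_sub, mul_smul d]; abel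
  obtain ⟨d, hd⟩ := h1
  have h2 := S.indep (fun i => c i.castSucc) (a ^ l • h - d • y 0) (by
    rw [eq_sub_of_add_eq hc, hd, pow_add]; module)
  intro i
  refine Fin.lastCases ?_ h2 i
  intro hu
  rw [hd] at hu
  exact ha ((isUnit_pow_iff hb0).1 (isUnit_of_mul_isUnit_left hu))

end BadStage
end Arch

section Arch

variable {R : Type u} [CommRing R] {H : Type u} [AddCommGroup H] [Module R H]

namespace BadStage

variable {J : Ideal R} {a : R} {k l e b : ℕ} {S : BadStage H J a k l e b} {y : ℕ → H}
  {x₀ : H} {n : ℕ} (hD : IsCompactOver R H x₀ n)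

theorem mkQ_eq (hy : ∀ i, y i = S.g i + S.Q i • y (i + 1)) (i t : ℕ) :
    S.F.mkQ (y i) = tailProd S.Q i t • S.F.mkQ (y (i + t)) := by
  obtain ⟨f, hf, h⟩ := exists_eq_add_smul hy i t
  rw [h, map_add, map_smul]
  simp [hf]

include hD in
theorem ext_bad (hy : ∀ i, y i = S.g i + S.Q i • y (i + 1)) (hkl : k + 1 ≤ l)
    (hle : l + 1 ≤ e) {p : ℕ → R} (hra : ∀ i, tailProd p 0 i ∣ a) {g : ℕ → R}
    (hg : ∀ z, ∃ i, ¬tailProd p 0 i ∣ z - ∑ j ∈ Finset.range i, tailProd p 0 j * g j)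
    (j : ℕ → ℕ) (hj : ∀ i m, tailProd S.Q (j i) m ∣ p i) (f : H) :
    ∃ i, ∀ w ∈ S.ext hy, f - ∑ q ∈ Finset.range i,
      (tailProd p 0 (q + 1) * tailProd S.Q 0 (j q)) • (g (q + 1) • y (j q))
        ≠ (tailProd p 0 (i + 1) * tailProd S.Q 0 (j i)) • w := by
  by_contra! hcon
  set π := S.F.mkQ
  have hY : ∀ i, π (y 0) = tailProd S.Q 0 i • π (y i) := fun i => by
    have := mkQ_eq hy 0 i
    rwa [zero_add] at this
  have hw : ∀ i, ∀ w ∈ S.ext hy, ∃ t,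
      π ((tailProd p 0 (i + 1) * tailProd S.Q 0 (j i)) • w) = (tailProd p 0 i * t) • π (y 0) := by
    rintro i _ ⟨q, f0, hf0, d, rfl⟩
    have h1 : ∃ t : R, p i • π (y q) = t • π (y (j i)) := by
      rcases le_total q (j i) with h | h
      · obtain ⟨s, hs⟩ := Nat.exists_eq_add_of_le h
        exact ⟨p i * tailProd S.Q q s, by rw [mkQ_eq hy q s, ← hs, mul_smul]⟩
      · obtain ⟨s, hs⟩ := Nat.exists_eq_add_of_le h
        obtain ⟨u, hu⟩ := hj i s
        exact ⟨u, by rw [hu, mkQ_eq hy (j i) s, ← hs, ← mul_smul, mul_comm u]⟩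
    obtain ⟨t, ht⟩ := h1
    refine ⟨d * t, ?_⟩
    have h2 : π (f0 + d • y q) = d • π (y q) := by
      rw [map_add, map_smul]; simp [π, hf0]
    rw [map_smul, h2, tailProd_succ, zero_add, hY (j i)]
    calc _ = (tailProd p 0 i * tailProd S.Q 0 (j i) * d) • (p i • π (y q)) := by module
      _ = _ := by rw [ht]; module
  have hsum : ∀ i, ∃ t, π f = (∑ q ∈ Finset.range i, tailProd p 0 (q + 1) * g (q + 1)
      + tailProd p 0 i * t) • π (y 0) := by
    intro i
    obtain ⟨w, hw1, hw2⟩ := hcon i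
    obtain ⟨t, ht⟩ := hw i w hw1
    refine ⟨t, ?_⟩
    rw [sub_eq_iff_eq_add] at hw2
    rw [hw2, map_add, ht, add_smul, add_comm, map_sum, Finset.sum_smul]
    congr 1
    refine Finset.sum_congr rfl fun q _ => ?_
    rw [map_smul, map_smul, hY (j q)]
    module
  obtain ⟨t0, ht0⟩ := hsum 0
  obtain ⟨i, hi⟩ := hg (t0 + g 0)
  obtain ⟨t, ht⟩ := hsum i
  refine hi ?_
  have h1 : (t0 - (∑ q ∈ Finset.range i, tailProd p 0 (q + 1) * g (q + 1)
      + tailProd p 0 i * t)) • y 0 ∈ S.F := by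
    rw [← Submodule.Quotient.mk_eq_zero, ← Submodule.mkQ_apply, map_smul, sub_smul, ← ht]
    rw [ht0]; simp [π]
  have h2 := pow_dvd_of_smul_mem hD hy hkl (by omega) h1
  have h3 : tailProd p 0 i ∣ a ^ (e - l) := (hra i).trans (dvd_pow_self a (by omega))
  have h4 : ∑ q ∈ Finset.range i, tailProd p 0 (q + 1) * g (q + 1) + g 0
      = ∑ q ∈ Finset.range i, tailProd p 0 q * g q + tailProd p 0 i * g i := by
    rw [← Finset.sum_range_succ, Finset.sum_range_succ', tailProd_zero, one_mul]
  obtain ⟨u, hu⟩ := h3.trans h2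
  exact ⟨u + t + g i, by linear_combination hu + h4⟩

include hD in
theorem next [IsLocalRing R] (hJJ : ∀ s ∈ J, ∃ s' ∈ J, ∃ s'' ∈ J, s = s' * s'')
    {p : ℕ → R} (hpJ : ∀ i, p i ∈ J) (hT : TailDvd J p) (hra : ∀ i, tailProd p 0 i ∣ a)
    {g : ℕ → R}
    (hg : ∀ z, ∃ i, ¬tailProd p 0 i ∣ z - ∑ j ∈ Finset.range i, tailProd p 0 j * g j)
    (ha : ¬IsUnit a) (S : BadStage H J a k l (e + 2 * l) b) (hkl : k + 2 ≤ l) (hb0 : b ≠ 0)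
    (hb : b ≤ e + l) (hae : a ^ (e + l) ≠ 0) :
    Nonempty (BadStage H J a (k + 1) l e (b + l)) := by
  obtain ⟨y, hy⟩ := hD.recursive S.g S.Q
  choose j0 hj0 using fun i => S.tail (p i) (hpJ i)
  let j : ℕ → ℕ := fun i => i + ∑ q ∈ Finset.range (i + 1), j0 q
  have hj : ∀ i m, tailProd S.Q (j i) m ∣ p i := fun i m =>
    tailProd_dvd_of_le (hj0 i) ((Finset.single_le_sum (f := j0) (fun _ _ => Nat.zero_le _)
      (Finset.self_mem_range_succ i)).trans (Nat.le_add_left _ _)) m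
  have hij : ∀ i, i ≤ j i := fun i => Nat.le_add_right _ _
  have hmono : Monotone j := monotone_nat_of_le_succ fun i => by
    simp only [j, Finset.sum_range_succ _ (i + 1)]
    omega
  have hQ' : ∀ i m, tailProd (fun i => p (i + 1) * tailProd S.Q (j i) (j (i + 1) - j i)) i m
      = tailProd p (i + 1) m * tailProd S.Q (j i) (j (i + m) - j i) := by
    intro i m
    induction m with
    | zero => simp
    | succ m ih =>
      have h1 : j (i + m + 1) - j i = (j (i + m) - j i) + (j (i + m + 1) - j (i + m)) := by
        have := hmono (Nat.le_add_right i m)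
        have := hmono (Nat.le_succ (i + m))
        simp only [Nat.succ_eq_add_one] at this
        omega
      rw [tailProd_succ, ih, tailProd_succ, ← add_assoc, h1, tailProd_add,
        Nat.add_sub_cancel' (hmono (Nat.le_add_right i m)), add_right_comm i 1 m]
      ring
  have e1 : e + 2 * l - l = e + l := by omega
  refine ⟨{
    F := S.ext hy
    Q := fun i => p (i + 1) * tailProd S.Q (j i) (j (i + 1) - j i)
    σ := fun i => tailProd p 0 (i + 1) * tailProd S.Q 0 (j i)
    x := Fin.snoc S.x (y 0)
    g := fun i => g (i + 1) • y (j i)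
    tail := ?_
    σ_succ := ?_
    σ_dvd := ?_
    x_mem := ?_
    g_mem := fun i => (S.ext hy).smul_mem _ (mem_ext hy _)
    bad := fun f _ => ext_bad hD hy (by omega) (by omega) hra hg j hj f
    pure := fun r hr => ext_pure hD hy (by omega) (by omega)
      (hr.trans (pow_dvd_pow a (by omega)))
    torsion := fun f hf => ext_torsion hD hy (by omega) rfl hae hf
    indep := snoc_indep hD ha hy (by omega) (by omega) (by omega) hb0 }⟩
  · intro s hs
    obtain ⟨s', hs', s'', hs'', rfl⟩ := hJJ s hs
    obtain ⟨u, hu⟩ := hT s' hs'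
    obtain ⟨v, hv⟩ := S.tail s'' hs''
    refine ⟨u + v, fun m => ?_⟩
    rw [hQ']
    exact mul_dvd_mul (tailProd_dvd_of_le hu (by omega) m)
      (tailProd_dvd_of_le hv ((Nat.le_add_left v u).trans (hij _)) _)
  · intro i
    have h1 : j (i + 1) = j i + (j (i + 1) - j i) :=
      (Nat.add_sub_cancel' (hmono (Nat.le_succ i))).symm
    have h2 : tailProd S.Q 0 (j (i + 1))
        = tailProd S.Q 0 (j i) * tailProd S.Q (j i) (j (i + 1) - j i) := by
      conv_lhs => rw [h1, tailProd_add, zero_add]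
    rw [tailProd_succ, h2, zero_add]
    ring
  · intro i
    rw [pow_succ' a (k + 1)]
    exact mul_dvd_mul (hra _) (S.tailProd_dvd 0 _)
  · intro i
    refine Fin.lastCases ?_ (fun i => ?_) i
    · rw [Fin.snoc_last]; exact mem_ext hy 0
    · rw [Fin.snoc_castSucc]; exact le_ext hy (S.x_mem i)

end BadStage

theorem IsCompactOver.exists_series_limit [IsLocalRing R] {x₀ : H} {n : ℕ}
    (hD : IsCompactOver R H x₀ n) {J : Ideal R}
    (hJJ : ∀ s ∈ J, ∃ s' ∈ J, ∃ s'' ∈ J, s = s' * s'')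
    {p : ℕ → R} (hpJ : ∀ i, p i ∈ J) (hT : TailDvd J p) {a : R} (ha : ¬IsUnit a)
    (hra : ∀ i, tailProd p 0 i ∣ a) (haK : a ^ (3 * (n + 2) * (n + 2)) ≠ 0) (g : ℕ → R) :
    ∃ z, ∀ i, tailProd p 0 i ∣ z - ∑ j ∈ Finset.range i, tailProd p 0 j * g j := by
  by_contra! hg
  have hpow : ∀ m ≤ 3 * (n + 2) * (n + 2), a ^ m ≠ 0 := fun m hm h =>
    haK (by rw [← Nat.sub_add_cancel hm, pow_add, h, mul_zero])
  have main : ∀ k t, k + t = n → Nonempty (BadStage H J a k (n + 2)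
      (2 * (n + 2) * t + (1 + n * (n + 2))) (1 + k * (n + 2))) := by
    intro k
    induction k with
    | zero =>
      intro t ht
      obtain rfl : t = n := by omega
      refine ⟨{
        F := Submodule.span R {x₀}
        Q := p
        σ := tailProd p 0
        x := fun _ => x₀
        g := fun i => g i • x₀
        tail := hT
        σ_succ := fun i => by rw [tailProd_succ, zero_add]
        σ_dvd := fun i => by rw [zero_add, pow_one]; exact hra i
        x_mem := fun _ => Submodule.mem_span_singleton_self _
        g_mem := fun _ => Submodule.smul_mem _ _ (Submodule.mem_span_singleton_self _)
        bad := ?_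
        pure := ?_
        torsion := ?_
        indep := ?_ }⟩
      · intro f hf
        obtain ⟨c, rfl⟩ := Submodule.mem_span_singleton.1 hf
        obtain ⟨i, hi⟩ := hg c
        refine ⟨i, fun w hw h => hi (hD.pure _ _ w ?_)⟩
        rw [← h, sub_smul, Finset.sum_smul]
        simp only [mul_smul]
      · intro r _ h hrh
        obtain ⟨c, hc⟩ := Submodule.mem_span_singleton.1 hrh
        obtain ⟨d, rfl⟩ := hD.pure _ _ _ hc
        exact ⟨d • x₀, Submodule.smul_mem _ _ (Submodule.mem_span_singleton_self _), by
          rw [← hc, mul_smul]⟩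
      · intro f hf h0
        obtain ⟨c, rfl⟩ := Submodule.mem_span_singleton.1 hf
        have h1 : a ^ (2 * (t + 2) * t + (1 + t * (t + 2))) * c = 0 :=
          zero_dvd_iff.1 (hD.pure _ 0 0 (by rw [mul_smul, h0, zero_smul]))
        rcases hD.total (a ^ (t + 2)) c with ⟨d, rfl⟩ | ⟨d, hd⟩
        · exact ⟨d • x₀, Submodule.smul_mem _ _ (Submodule.mem_span_singleton_self _),
            mul_smul _ _ _⟩
        · refine absurd ?_ (hpow (2 * (t + 2) * t + (1 + t * (t + 2)) + (t + 2)) ?_)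
          · rw [pow_add, hd, ← mul_assoc, h1, zero_mul]
          · nlinarith
      · intro c h hc i hu
        simp only [Fin.sum_univ_succ, Finset.univ_eq_empty, Finset.sum_empty, add_zero,
          zero_mul, pow_one] at hc
        obtain rfl : i = 0 := Fin.fin_one_eq_zero i
        exact ha (isUnit_of_dvd_unit (hD.pure _ _ _ hc) hu)
    | succ k ih =>
      intro t ht
      obtain ⟨S⟩ := ih (t + 1) (by omega)
      have h1 : 2 * (n + 2) * (t + 1) + (1 + n * (n + 2))
          = 2 * (n + 2) * t + (1 + n * (n + 2)) + 2 * (n + 2) := by ring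
      rw [h1] at S
      have hkn : k * (n + 2) ≤ n * (n + 2) := Nat.mul_le_mul_right _ (by omega)
      have htn : t * (n + 2) ≤ n * (n + 2) := Nat.mul_le_mul_right _ (by omega)
      have := S.next hD hJJ hpJ hT hra hg ha (by omega) (by omega) (by omega)
        (hpow _ (by nlinarith))
      rwa [show 1 + (k + 1) * (n + 2) = 1 + k * (n + 2) + (n + 2) by ring]
  obtain ⟨S⟩ := main n 0 (by omega)
  have := hD.rank (n + 1) S.x fun c hc => S.indep c 0 (by rw [hc, smul_zero])
  omega

end Arch

section Gap

variable {R : Type u} [CommRing R]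

/-- Multiplication by an element outside `J` preserves non-membership in `A`, and each element
outside `A` stays outside after multiplication by some element of `J`. -/
structure IsGap (J A : Ideal R) : Prop where
  mem_of_mul_mem : ∀ s ∉ J, ∀ b, s * b ∈ A → b ∈ A
  exists_mul_notMem : ∀ r ∉ A, ∃ q ∈ J, r * q ∉ A

/-- Every compatible family of residues modulo the principal ideals not inside `A` has a common
representative. -/
def IsSolvableAt (A : Ideal R) : Prop :=
  ∀ a : R → R, (∀ r ∉ A, ∀ r' ∉ A, r ∣ r' → r ∣ a r' - a r) → ∃ b, ∀ r ∉ A, r ∣ b - a r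

/-- Solvability at all ideals strictly above `L` that are gaps of `J`. -/
def IsSolvableAbove (L J : Ideal R) : Prop := ∀ A, L < A → IsGap J A → IsSolvableAt A

theorem dvd_of_mem_of_notMem (hd : ∀ a b : R, a ∣ b ∨ b ∣ a) {A : Ideal R} {r b : R}
    (hr : r ∉ A) (hb : b ∈ A) : r ∣ b :=
  (hd r b).resolve_right fun h => hr (A.mem_of_dvd h hb)

theorem IsSolvableAt.of_one_mem {A : Ideal R} (h : (1 : R) ∈ A) : IsSolvableAt A :=
  fun _ _ => ⟨0, fun r hr => absurd (A.mem_of_dvd (one_dvd r) h) hr⟩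

namespace IsGap

variable {J A : Ideal R} (hA : IsGap J A) (hd : ∀ a b : R, a ∣ b ∨ b ∣ a)
include hA

include hd in
theorem exists_sq_dvd (hnil : ∀ p ∈ J, ∃ k, p ^ k ∈ A) (h1 : (1 : R) ∉ A) :
    ∀ s ∈ J, ∃ t ∈ J, t ^ 2 ∣ s := by
  intro s hs
  by_contra! hcon
  have hmul : ∀ r ∉ A, r * s ∉ A := by
    intro r hr hrs
    obtain ⟨q, hq, hrq⟩ := hA.exists_mul_notMem r hr
    rcases hd s q with ⟨u, rfl⟩ | ⟨u, rfl⟩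
    · exact hrq (by rw [← mul_assoc]; exact A.mul_mem_right _ hrs)
    · by_cases hu : u ∈ J
      · rcases hd q u with h | h
        · exact hcon q hq (by rw [sq]; exact mul_dvd_mul_left q h)
        · exact hcon u hu (by rw [sq]; exact mul_dvd_mul_right h u)
      · exact hrq (hA.mem_of_mul_mem u hu _ (by convert hrs using 1; ring))
  obtain ⟨k, hk⟩ := hnil s hs
  have : ∀ k, s ^ k ∉ A := fun k => by
    induction k with
    | zero => simpa using h1
    | succ k ih => rw [pow_succ]; exact hmul _ ih
  exact this k hk

include hd in
theorem exists_pow_notMem (hnil : ∀ p ∈ J, ∃ k, p ^ k ∈ A) (h1 : (1 : R) ∉ A) (K : ℕ) :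
    ∃ a ∈ J, a ^ K ∉ A := by
  have : ∀ k : ℕ, ∃ a ∈ J, a ^ (2 ^ k) ∉ A := by
    intro k
    induction k with
    | zero =>
      obtain ⟨q, hq, h⟩ := hA.exists_mul_notMem 1 h1
      exact ⟨q, hq, by simpa using h⟩
    | succ k ih =>
      obtain ⟨a, ha, h⟩ := ih
      obtain ⟨t, ht, hta⟩ := hA.exists_sq_dvd hd hnil h1 a ha
      refine ⟨t, ht, fun hmem => h (A.mem_of_dvd ?_ hmem)⟩
      rw [pow_succ', pow_mul]
      exact pow_dvd_pow_of_dvd hta _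
  obtain ⟨a, ha, h⟩ := this K
  exact ⟨a, ha, fun hmem => h (A.mem_of_dvd (pow_dvd_pow a Nat.lt_two_pow_self.le) hmem)⟩

include hd in
theorem exists_seq_cofinal (hnil : ∀ p ∈ J, ∃ k, p ^ k ∈ A) (h1 : (1 : R) ∉ A) :
    ∃ β : ℕ → R, (∀ i, β i ∉ A) ∧ ∀ b ∉ A, ∃ i, b ∣ β i := by
  classical
  choose ϖ hϖJ hϖ using hA.exists_pow_notMem hd hnil h1
  have hfind : ∀ K, ∃ e, ϖ K ^ e ∉ A ∧ ϖ K ^ (e + 1) ∈ A := by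
    intro K
    have hex := hnil _ (hϖJ K)
    have h0 : Nat.find hex ≠ 0 := fun h => h1 (by simpa [h] using Nat.find_spec hex)
    obtain ⟨e, he⟩ := Nat.exists_eq_succ_of_ne_zero h0
    exact ⟨e, Nat.find_min hex (by omega), by
      rw [← Nat.succ_eq_add_one, ← he]; exact Nat.find_spec hex⟩
  choose e he he' using hfind
  refine ⟨fun K => ϖ K ^ e K, he, fun b hb => ?_⟩
  obtain ⟨q, hq, hbq⟩ := hA.exists_mul_notMem b hb
  obtain ⟨k, hk⟩ := hnil q hq
  have h2 : ϖ k ∣ q := (hd _ _).resolve_right fun h =>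
    hϖ k (A.mem_of_dvd (pow_dvd_pow_of_dvd h k) hk)
  refine ⟨k, (hd _ _).resolve_right fun h => hbq (A.mem_of_dvd ?_ (he' k))⟩
  rw [pow_succ]
  exact mul_dvd_mul h h2

include hd in
theorem exists_step {r β : R} (hr : r ∉ A) (hβ : β ∉ A) : ∃ p ∈ J, r * p ∉ A ∧ β ∣ r * p := by
  obtain ⟨q, hq, h⟩ := hA.exists_mul_notMem r hr
  rcases hd β (r * q) with h1 | ⟨u, rfl⟩
  · exact ⟨q, hq, h, h1⟩
  · exact ⟨q * u, J.mul_mem_right _ hq, by rwa [← mul_assoc], by rw [mul_assoc]⟩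

include hd in
theorem exists_tailProd (hnil : ∀ p ∈ J, ∃ k, p ^ k ∈ A) (h1 : (1 : R) ∉ A) :
    ∃ p : ℕ → R, (∀ i, p i ∈ J) ∧ (∀ i, tailProd p 0 i ∉ A) ∧
      (∀ b ∉ A, ∃ i, b ∣ tailProd p 0 i) ∧ TailDvd J p := by
  obtain ⟨β, hβ, hβc⟩ := hA.exists_seq_cofinal hd hnil h1
  choose pf hpJ hpA hpd using fun (r : {r // r ∉ A}) i => hA.exists_step hd r.2 (hβ i)
  let r : ℕ → {r // r ∉ A} := fun i => Nat.rec ⟨1, h1⟩ (fun i r => ⟨r.1 * pf r i, hpA r i⟩) i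
  let p : ℕ → R := fun i => pf (r i) i
  have hr : ∀ i, tailProd p 0 i = (r i).1 := by
    intro i
    induction i with
    | zero => exact tailProd_zero p 0
    | succ i ih => rw [tailProd_succ, ih, zero_add]
  have hcof : ∀ b ∉ A, ∃ i, b ∣ tailProd p 0 i := fun b hb => by
    obtain ⟨i, hi⟩ := hβc b hb
    exact ⟨i + 1, hi.trans (by rw [hr]; exact hpd (r i) i)⟩
  have hnot : ∀ i, tailProd p 0 i ∉ A := fun i => by rw [hr]; exact (r i).2
  refine ⟨p, fun i => hpJ _ _, hnot, hcof, fun s hs => ?_⟩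
  classical
  have hex := hnil s hs
  have h0 : Nat.find hex ≠ 0 := fun h => h1 (by simpa [h] using Nat.find_spec hex)
  obtain ⟨e, he⟩ := Nat.exists_eq_succ_of_ne_zero h0
  obtain ⟨j, u, hj⟩ := hcof (s ^ e) (Nat.find_min hex (by omega))
  have hsj : tailProd p 0 j * s ∈ A := by
    have h2 := Nat.find_spec hex
    rw [he, Nat.succ_eq_add_one, pow_succ] at h2
    rw [hj]
    exact A.mem_of_dvd ⟨u, by ring⟩ h2
  refine ⟨j, fun m => (hd _ _).resolve_right fun h => hnot (j + m) ?_⟩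
  rw [tailProd_add, zero_add]
  exact A.mem_of_dvd (mul_dvd_mul_left _ h) hsj

variable {H : Type u} [AddCommGroup H] [Module R H]

/-- The archimedean case. -/
theorem isSolvableAt [IsLocalRing R] {x₀ : H} {n : ℕ}
    (hD : IsCompactOver R H x₀ n) (hJ : J ≠ ⊤) (hnil : ∀ p ∈ J, ∃ k, p ^ k ∈ A) :
    IsSolvableAt A := by
  have hd := hD.total
  by_cases h1 : (1 : R) ∈ A
  · exact .of_one_mem h1
  intro c hc
  obtain ⟨p, hpJ, hpA, hcof, hT⟩ := hA.exists_tailProd hd hnil h1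
  obtain ⟨a, haJ, haK⟩ := hA.exists_pow_notMem hd hnil h1 (3 * (n + 2) * (n + 2))
  obtain ⟨j, hj⟩ := hT a haJ
  let p' : ℕ → R := fun i => p (j + i)
  have hp' : ∀ i m, tailProd p' i m = tailProd p (j + i) m := fun i m => by
    simp [tailProd, p', add_assoc]
  have hstep : ∀ i, tailProd p 0 (j + i) ∣
      c (tailProd p 0 (j + i + 1)) - c (tailProd p 0 (j + i)) :=
    fun i => hc _ (hpA _) _ (hpA _) (Dvd.intro _ (tailProd_succ p 0 (j + i)).symm)
  choose g hg using hstep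
  obtain ⟨z, hz⟩ := hD.exists_series_limit (J := J) (fun s hs => by
      obtain ⟨t, ht, u, hu⟩ := hA.exists_sq_dvd hd hnil h1 s hs
      exact ⟨t, ht, t * u, J.mul_mem_right _ ht, by rw [hu]; ring⟩)
    (p := p') (fun i => hpJ _) (fun s hs => by
      obtain ⟨t, ht⟩ := hT s hs
      exact ⟨t, fun m => by rw [hp']; exact tailProd_dvd_of_le ht (Nat.le_add_left _ _) m⟩)
    (a := a) (fun hu => hJ (J.eq_top_of_isUnit_mem haJ hu))
    (fun i => by rw [hp']; exact hj i) (fun h => haK (by rw [h]; exact A.zero_mem)) g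
  have hsum : ∀ i, c (tailProd p 0 (j + i)) = c (tailProd p 0 j)
      + tailProd p 0 j * ∑ l ∈ Finset.range i, tailProd p' 0 l * g l := by
    intro i
    induction i with
    | zero => simp
    | succ i ih =>
      have h2 : tailProd p 0 (j + i) = tailProd p 0 j * tailProd p' 0 i := by
        rw [tailProd_add, zero_add, hp', add_zero]
      rw [Finset.sum_range_succ, ← add_assoc j i 1]
      linear_combination hg i + ih + g i * h2
  refine ⟨c (tailProd p 0 j) + tailProd p 0 j * z, fun r hr => ?_⟩
  obtain ⟨i, hi⟩ := hcof r hr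
  have hri : r ∣ tailProd p 0 (j + i) := hi.trans (by
    rw [add_comm, tailProd_add]; exact Dvd.intro _ rfl)
  have h2 : tailProd p 0 (j + i) ∣ c (tailProd p 0 j) + tailProd p 0 j * z
      - c (tailProd p 0 (j + i)) := by
    rw [hsum i, tailProd_add, zero_add, add_sub_add_left_eq_sub, ← mul_sub]
    have := hz i
    rw [hp', add_zero] at this
    exact mul_dvd_mul_left _ this
  have h3 := dvd_add (hri.trans h2) (hc r hr _ (hpA (j + i)) hri)
  simpa using h3

end IsGap
end Gap

section Rank

variable {R : Type u} [CommRing R]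

theorem isPrime_nilradical_of_total [Nontrivial R] (hd : ∀ a b : R, a ∣ b ∨ b ∣ a) :
    (nilradical R).IsPrime := by
  refine ⟨fun h => not_isNilpotent_one (h ▸ Submodule.mem_top : (1 : R) ∈ nilradical R), ?_⟩
  intro x y hxy
  have h2 : ∀ x y : R, x ∣ y → x * y ∈ nilradical R → y ∈ nilradical R := by
    rintro x _ ⟨u, rfl⟩ h
    have : (x * u) ^ 2 ∈ nilradical R := by
      have := (nilradical R).mul_mem_left u h
      convert this using 1; ring
    obtain ⟨k, hk⟩ := this
    exact ⟨2 * k, by rw [pow_mul]; exact hk⟩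
  rcases hd x y with h | h
  · exact .inr (h2 x y h hxy)
  · exact .inl (h2 y x h (by rwa [mul_comm]))

theorem dvd_of_mem_of_notMem' (hd : ∀ a b : R, a ∣ b ∨ b ∣ a) {L : Ideal R} [hL : L.IsPrime]
    {c ℓ : R} (hc : c ∉ L) (hℓ : ℓ ∈ L) : ∃ ℓ' ∈ L, ℓ = c * ℓ' := by
  obtain ⟨u, rfl⟩ := dvd_of_mem_of_notMem hd hc hℓ
  exact ⟨u, (hL.mem_or_mem hℓ).resolve_left hc, rfl⟩

theorem exists_normalized (hd : ∀ a b : R, a ∣ b ∨ b ∣ a) {L : Ideal R} {m : ℕ} (c : Fin m → R)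
    (hc : ∃ i, c i ∉ L) : ∃ (i : Fin m) (d : Fin m → R), c = c i • d ∧ d i = 1 ∧ c i ∉ L := by
  classical
  obtain ⟨j, hj⟩ := hc
  obtain ⟨i, -, hi⟩ : ∃ i ∈ Finset.univ, ∀ j ∈ Finset.univ, c i ∣ c j := by
    have : ∀ s : Finset (Fin m), s.Nonempty → ∃ i ∈ s, ∀ j ∈ s, c i ∣ c j := by
      intro s hs
      induction hs using Finset.Nonempty.cons_induction with
      | singleton a => exact ⟨a, by simp, by simp⟩
      | cons a s ha hs ih =>
        obtain ⟨i, hi, h⟩ := ih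
        rcases hd (c i) (c a) with h1 | h1
        · refine ⟨i, by simp [hi], fun j hj => ?_⟩
          rcases Finset.mem_cons.1 hj with rfl | hj
          · exact h1
          · exact h j hj
        · refine ⟨a, by simp, fun j hj => ?_⟩
          rcases Finset.mem_cons.1 hj with rfl | hj
          · exact dvd_rfl
          · exact h1.trans (h j hj)
    exact this _ ⟨j, Finset.mem_univ j⟩
  choose d hd' using fun j => hi j (Finset.mem_univ j)
  refine ⟨i, Function.update d i 1, ?_, by simp, fun h => hj (L.mem_of_dvd (hi j (by simp)) h)⟩
  ext j
  by_cases hij : j = i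
  · subst hij; simp
  · simp [hij, hd' j]

variable {H : Type u} [AddCommGroup H] [Module R H]

/-- The submodule of the elements that agree with an element of `L • H` up to multiplication by
an element that is not nilpotent. -/
def satSubmodule (H : Type u) [AddCommGroup H] [Module R H] (hN : (nilradical R).IsPrime)
    (L : Ideal R) : Submodule R H where
  carrier := {h | ∃ s ∉ nilradical R, ∃ w ∈ (L • ⊤ : Submodule R H), s • h = s • w}
  zero_mem' := ⟨1, fun h => hN.ne_top ((Ideal.eq_top_iff_one _).2 h), 0, zero_mem _, rfl⟩
  add_mem' := by
    rintro h h' ⟨s, hs, w, hw, e⟩ ⟨s', hs', w', hw', e'⟩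
    refine ⟨s * s', fun hm => (hN.mem_or_mem hm).elim hs hs', w + w', add_mem hw hw', ?_⟩
    have h1 := congrArg (s' • ·) e
    have h2 := congrArg (s • ·) e'
    simp only [← mul_smul] at h1 h2
    rw [smul_add, smul_add, h2, mul_comm s s', h1]
  smul_mem' := by
    rintro r h ⟨s, hs, w, hw, e⟩
    exact ⟨s, hs, r • w, Submodule.smul_mem _ _ hw, by rw [smul_comm, e, smul_comm]⟩

section
variable (hd : ∀ a b : R, a ∣ b ∨ b ∣ a) {hN : (nilradical R).IsPrime}

theorem smul_mem_satSubmodule {L : Ideal R} {c : R} (hc : c ∈ L) (h : H) :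
    c • h ∈ satSubmodule H hN L :=
  ⟨1, fun h => hN.ne_top ((Ideal.eq_top_iff_one _).2 h), c • h,
    Submodule.smul_mem_smul hc Submodule.mem_top, rfl⟩

theorem satSubmodule_mono {L J : Ideal R} (h : L ≤ J) :
    satSubmodule H hN L ≤ satSubmodule H hN J := by
  rintro x ⟨s, hs, w, hw, e⟩
  exact ⟨s, hs, w, Submodule.smul_mono_left h hw, e⟩

include hd in
theorem mem_smul_top_iff {L : Ideal R} {w : H} :
    w ∈ (L • ⊤ : Submodule R H) ↔ ∃ ℓ ∈ L, ∃ h : H, w = ℓ • h := by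
  constructor
  · intro hw
    refine Submodule.smul_induction_on hw (fun r hr n _ => ⟨r, hr, n, rfl⟩) ?_
    · rintro _ _ ⟨ℓ, hℓ, h, rfl⟩ ⟨ℓ', hℓ', h', rfl⟩
      rcases hd ℓ ℓ' with ⟨u, rfl⟩ | ⟨u, rfl⟩
      · exact ⟨ℓ, hℓ, h + u • h', by module⟩
      · exact ⟨ℓ', hℓ', u • h + h', by module⟩
  · rintro ⟨ℓ, hℓ, h, rfl⟩
    exact Submodule.smul_mem_smul hℓ Submodule.mem_top

include hd in
theorem mem_satSubmodule_of_smul_mem {L : Ideal R} (hL : L.IsPrime) {c : R}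
    (hc : c ∉ L) {h : H} (h1 : c • h ∈ satSubmodule H hN L) : h ∈ satSubmodule H hN L := by
  obtain ⟨s, hs, w, hw, e⟩ := h1
  obtain ⟨ℓ, hℓ, h', rfl⟩ := (mem_smul_top_iff hd).1 hw
  obtain ⟨ℓ', hℓ', rfl⟩ := dvd_of_mem_of_notMem' hd hc hℓ
  refine ⟨s * c, fun hm => (hN.mem_or_mem hm).elim hs fun h => hc (nilradical_le_prime L h),
    ℓ' • h', Submodule.smul_mem_smul hℓ' Submodule.mem_top, ?_⟩
  rw [mul_smul, e]; module

/-- Linear independence modulo `satSubmodule H hN J`, with coefficients modulo `J`. -/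
def IndepMod (hN : (nilradical R).IsPrime) (J : Ideal R) {k : ℕ} (x : Fin k → H) : Prop :=
  ∀ c : Fin k → R, Fintype.linearCombination R x c ∈ satSubmodule H hN J → ∀ i, c i ∈ J

include hd in
theorem IndepMod.anti {L J : Ideal R} (hL : L.IsPrime) (hJ : J ≠ ⊤) (hLJ : L ≤ J) {k : ℕ}
    {x : Fin k → H} (hx : IndepMod hN J x) : IndepMod hN L x := by
  intro c hc
  by_contra! hcon
  obtain ⟨i, d, hcd, hdi, hci⟩ := exists_normalized hd c hcon
  rw [hcd, map_smul] at hc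
  have := hx d (satSubmodule_mono hLJ (mem_satSubmodule_of_smul_mem hd hL hci hc)) i
  rw [hdi] at this
  exact hJ ((Ideal.eq_top_iff_one _).2 this)

variable {x₀ : H} {n : ℕ} (hD : IsCompactOver R H x₀ n)
include hD

theorem IsCompactOver.mem_of_smul_mem {L : Ideal R} (hL : L.IsPrime) {c : R}
    (hc : c • x₀ ∈ satSubmodule H hN L) : c ∈ L := by
  obtain ⟨s, hs, w, hw, e⟩ := hc
  obtain ⟨ℓ, hℓ, h, rfl⟩ := (mem_smul_top_iff hD.total).1 hw
  obtain ⟨d, hd⟩ := hD.pure (s * c) (s * ℓ) h (by rw [mul_smul, e, mul_smul])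
  have h1 : s * (c - ℓ * d) ∈ nilradical R := by
    have : s * (c - ℓ * d) = 0 := by linear_combination hd
    rw [this]; exact zero_mem _
  have h2 := nilradical_le_prime L ((hN.mem_or_mem h1).resolve_left hs)
  simpa using L.add_mem h2 (L.mul_mem_right d hℓ)

theorem IsCompactOver.indepMod_single {L : Ideal R} (hL : L.IsPrime) :
    IndepMod hN L (fun _ : Fin 1 => x₀) := by
  intro c hc i
  obtain rfl : i = 0 := Fin.fin_one_eq_zero i
  exact hD.mem_of_smul_mem hL (by simpa [Fintype.linearCombination_apply] using hc)

theorem IsCompactOver.le_of_indepMod {L : Ideal R} (hL : L ≠ ⊤) {k : ℕ} {x : Fin k → H}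
    (hx : IndepMod hN L x) : k ≤ n :=
  hD.rank k x fun c hc i hu => hL (L.eq_top_of_isUnit_mem (hx c (by
    rw [Fintype.linearCombination_apply, hc]; exact zero_mem _) i) hu)

end

open Classical in
/-- The largest size of a family that is independent in the sense of `IndepMod`, capped at `n`. -/
noncomputable def indepRank (H : Type u) [AddCommGroup H] [Module R H]
    (hN : (nilradical R).IsPrime) (n : ℕ) (J : Ideal R) : ℕ :=
  Nat.findGreatest (fun k => ∃ x : Fin k → H, IndepMod hN J x) n

section
variable {hN : (nilradical R).IsPrime} {x₀ : H} {n : ℕ}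

theorem indepRank_le (J : Ideal R) : indepRank H hN n J ≤ n := by
  classical exact Nat.findGreatest_le _

theorem exists_indepMod (J : Ideal R) :
    ∃ x : Fin (indepRank H hN n J) → H, IndepMod hN J x := by
  classical
  exact Nat.findGreatest_spec (P := fun k => ∃ x : Fin k → H, IndepMod hN J x)
    (Nat.zero_le n) ⟨Fin.elim0, fun _ _ i => i.elim0⟩

variable (hD : IsCompactOver R H x₀ n)
include hD

theorem IsCompactOver.le_indepRank {J : Ideal R} (hJ : J ≠ ⊤) {k : ℕ} {x : Fin k → H}
    (hx : IndepMod hN J x) : k ≤ indepRank H hN n J := by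
  classical
  exact Nat.le_findGreatest (hD.le_of_indepMod hJ hx) ⟨x, hx⟩

theorem IsCompactOver.indepRank_anti {L J : Ideal R} (hL : L.IsPrime) (hJ : J ≠ ⊤) (hLJ : L ≤ J) :
    indepRank H hN n J ≤ indepRank H hN n L := by
  obtain ⟨x, hx⟩ := exists_indepMod (H := H) (hN := hN) (n := n) J
  exact hD.le_indepRank hL.ne_top (hx.anti hD.total hL hJ hLJ)

theorem IsCompactOver.indepRank_pos {J : Ideal R} (hJ : J.IsPrime) :
    0 < indepRank H hN n J :=
  hD.le_indepRank hJ.ne_top (hD.indepMod_single hJ)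

/-- On a plateau of the rank, an independent family of maximal size spans up to torsion. -/
theorem IsCompactOver.exists_smul_sub_mem {L J : Ideal R} (hL : L.IsPrime) (hJ : J.IsPrime)
    (hLJ : L ≤ J) (hrk : indepRank H hN n L = indepRank H hN n J)
    {x : Fin (indepRank H hN n J) → H} (hx : IndepMod hN J x) (h : H) :
    ∃ t ∉ J, ∃ c, t • h - Fintype.linearCombination R x c ∈ satSubmodule H hN L := by
  have hsnoc : ∀ c : Fin (indepRank H hN n J + 1) → R, Fintype.linearCombination R
      (Fin.snoc x h : Fin (indepRank H hN n J + 1) → H) c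
      = Fintype.linearCombination R x (fun i => c i.castSucc) + c (Fin.last _) • h := by
    intro c
    simp [Fintype.linearCombination_apply, Fin.sum_univ_castSucc]
  have hnot : ¬IndepMod hN L (Fin.snoc x h : Fin (indepRank H hN n J + 1) → H) := fun hcon => by
    have := hD.le_indepRank hL.ne_top hcon
    omega
  unfold IndepMod at hnot
  push Not at hnot
  obtain ⟨c, hc, hex⟩ := hnot
  obtain ⟨i, d, hcd, hdi, hci⟩ := exists_normalized hD.total c hex
  rw [hcd, map_smul] at hc
  have h1 := mem_satSubmodule_of_smul_mem hD.total hL hci hc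
  rw [hsnoc] at h1
  refine ⟨d (Fin.last _), fun ht => ?_, -(fun i => d i.castSucc), by
    rw [map_neg, sub_neg_eq_add, add_comm]; exact h1⟩
  have h2 := hx _ ((Submodule.add_mem_iff_left _ (smul_mem_satSubmodule ht h)).1
    (satSubmodule_mono hLJ h1))
  have h3 : d i ∈ J := Fin.lastCases (motive := fun i => d i ∈ J) ht h2 i
  rw [hdi] at h3
  exact hJ.ne_top ((Ideal.eq_top_iff_one _).2 h3)

end

theorem IsGap.dvd_of_dvd_mul {J A : Ideal R} (hA : IsGap J A)
    (hd : ∀ a b : R, a ∣ b ∨ b ∣ a) {d : R → R}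
    (hcomp : ∀ r ∉ A, ∀ r' ∉ A, r ∣ r' → r ∣ d r' - d r)
    (hdvd : ∀ r ∉ A, ∃ t ∉ J, r ∣ t * d r) : ∀ r ∉ A, r ∣ d r := by
  intro r hr
  obtain ⟨q, hq, hrq⟩ := hA.exists_mul_notMem r hr
  obtain ⟨t, ht, w, hw⟩ := hdvd _ hrq
  obtain ⟨q', rfl⟩ := dvd_of_mem_of_notMem hd ht hq
  have h1 : r * q' * w - d (r * (t * q')) ∈ A := hA.mem_of_mul_mem t ht _ (by
    have : t * (r * q' * w - d (r * (t * q'))) = 0 := by linear_combination -hw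
    rw [this]; exact zero_mem _)
  have h2 := dvd_of_mem_of_notMem hd hr h1
  have h3 := hcomp r hr _ hrq (Dvd.intro _ rfl)
  have h4 : r ∣ r * q' * w := ⟨q' * w, by ring⟩
  have h5 : d r = r * q' * w - (r * q' * w - d (r * (t * q'))) - (d (r * (t * q')) - d r) := by
    ring
  rw [h5]
  exact dvd_sub (dvd_sub h4 h2) h3

/-- The case where the rank is constant. -/
theorem IsCompactOver.isSolvableAbove_of_eq {hN : (nilradical R).IsPrime} {x₀ : H} {n : ℕ}
    (hD : IsCompactOver R H x₀ n) {L J : Ideal R} (hL : L.IsPrime) (hJ : J.IsPrime) (hLJ : L ≤ J)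
    (hrk : indepRank H hN n L = indepRank H hN n J) : IsSolvableAbove L J := by
  intro A hLA hA
  by_cases hA1 : (1 : R) ∈ A
  · exact .of_one_mem hA1
  intro a ha
  have hd := hD.total
  obtain ⟨x, hx⟩ := exists_indepMod (H := H) (hN := hN) (n := n) J
  let i0 : Fin (indepRank H hN n J) := ⟨0, hD.indepRank_pos hJ⟩
  have hxL := hx.anti hd hL hJ.ne_top hLJ
  set X := Fintype.linearCombination R x
  have hX : X (Pi.single i0 1) = x i0 := by
    rw [Fintype.linearCombination_apply_single, one_smul]
  obtain ⟨z, hz⟩ := hD.limit (J := {r // r ∉ A}) (fun r => r.1) (fun r => a r.1 • x i0) (by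
    intro r r' hrr
    obtain ⟨w, hw⟩ := ha _ r.2 _ r'.2 hrr
    exact ⟨w • x i0, by rw [← sub_smul, hw, mul_smul]⟩)
  obtain ⟨t, ht, c, hc⟩ := hD.exists_smul_sub_mem hL hJ hLJ hrk hx z
  have h1 : ∀ r ∉ A, r ∣ c i0 - t * a r := by
    refine hA.dvd_of_dvd_mul hd (fun r hr r' hr' hrr => ?_) (fun r hr => ?_)
    · have h := (ha r hr r' hr' hrr).mul_left t
      have h2 : c i0 - t * a r' - (c i0 - t * a r) = -(t * (a r' - a r)) := by ring
      rw [h2]; exact (dvd_neg).2 h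
    · obtain ⟨h, hh⟩ := hz ⟨r, hr⟩
      obtain ⟨t', ht', c', hc'⟩ := hD.exists_smul_sub_mem hL hJ hLJ hrk hx h
      refine ⟨t', ht', ?_⟩
      have h2 : X (t' • c - (t' * t * a r) • Pi.single i0 1 - (r * t) • c')
          ∈ satSubmodule H hN L := by
        rw [map_sub, map_sub, map_smul, map_smul, map_smul, hX]
        have h3 := Submodule.sub_mem _ (Submodule.smul_mem _ (r * t) hc')
          (Submodule.smul_mem _ t' hc)
        have h4 : (t' * t) • (z - a r • x i0 - r • h) = 0 := by rw [hh, sub_self, smul_zero]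
        have h5 : t' • X c - (t' * t * a r) • x i0 - (r * t) • X c'
            = (r * t) • (t' • h - X c') - t' • (t • z - X c)
              + (t' * t) • (z - a r • x i0 - r • h) := by module
        rw [h5, h4, add_zero]; exact h3
      have h3 := hxL _ h2 i0
      simp only [Pi.sub_apply, Pi.smul_apply, Pi.single_eq_same, smul_eq_mul, mul_one] at h3
      have h4 := dvd_of_mem_of_notMem hd hr (hLA.le h3)
      have h5 : t' * (c i0 - t * a r)
          = (t' * c i0 - t' * t * a r - r * t * c' i0) + r * (t * c' i0) := by ring
      rw [h5]; exact dvd_add h4 (Dvd.intro _ rfl)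
  obtain ⟨q, hq, h1q⟩ := hA.exists_mul_notMem 1 hA1
  rw [one_mul] at h1q
  obtain ⟨b, hb⟩ : t ∣ c i0 := by
    have h2 := (dvd_of_mem_of_notMem hd ht hq).trans (h1 q h1q)
    simpa using dvd_add h2 (Dvd.intro (a q) rfl)
  refine ⟨b, hA.dvd_of_dvd_mul hd (fun r hr r' hr' hrr => ?_) (fun r hr => ⟨t, ht, ?_⟩)⟩
  · rw [sub_sub_sub_cancel_left, ← neg_sub]; exact (dvd_neg).2 (ha r hr r' hr' hrr)
  · rw [mul_sub, ← hb]; exact h1 r hr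

end Rank

section Transfinite

theorem exists_transfinite_sequence {I : Type u} [LinearOrder I] [WellFoundedLT I] {X : Type v}
    [Nonempty X] (P : I → X → Prop) (r : I → I → X → X → Prop)
    (step : ∀ i (h : I → X), (∀ j < i, P j (h j)) → (∀ k < i, ∀ j < k, r j k (h j) (h k)) →
      ∃ x, P i x ∧ ∀ j < i, r j i (h j) x) :
    ∃ h : I → X, (∀ i, P i (h i)) ∧ ∀ i, ∀ j < i, r j i (h j) (h i) := by
  classical
  let x0 : X := Classical.arbitrary X
  let F : ∀ i : I, (∀ j, j < i → X) → X := fun i prev =>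
    if hx : ∃ x, P i x ∧ ∀ j (hj : j < i), r j i (prev j hj) x then hx.choose else x0
  let h : I → X := (wellFounded_lt (α := I)).fix F
  have hF : ∀ i, h i = F i fun j _ => h j := fun i => WellFounded.fix_eq _ F i
  have main : ∀ i, P i (h i) ∧ ∀ j < i, r j i (h j) (h i) := by
    intro i
    induction i using WellFoundedLT.induction with
    | ind i ih =>
      have hex : ∃ x, P i x ∧ ∀ j (_ : j < i), r j i (h j) x :=
        step i h (fun j hj => (ih j hj).1) fun k hk j hj => (ih k hk).2 j hj
      have h2 : h i = hex.choose := by rw [hF i]; exact dif_pos hex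
      rw [h2]
      exact hex.choose_spec
  exact ⟨h, fun i => (main i).1, fun i => (main i).2⟩

open Cardinal in
theorem exists_wellOrder_cofinal {R : Type u} [CommRing R] (hd : ∀ a b : R, a ∣ b ∨ b ∣ a)
    (A : Ideal R) : ∃ (I : Type u) (_ : LinearOrder I) (_ : WellFoundedLT I) (β : I → R),
      (∀ i, β i ∉ A) ∧ (∀ b ∉ A, ∃ i, b ∣ β i) ∧
      ∀ (i : I) (b : I → R), (∀ j < i, b j ∉ A) → ∃ c ∉ A, ∀ j < i, b j ∣ c := by
  let _ : Preorder {r // r ∉ A} :=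
    { le := fun a b => a.1 ∣ b.1
      le_refl := fun a => dvd_rfl
      le_trans := fun a b c => dvd_trans }
  obtain ⟨s, hs, hcard⟩ := Order.exists_cof_eq {r // r ∉ A}
  let I := (Order.cof {r // r ∉ A}).ord.ToType
  have hI : #I = #s := by rw [hcard]; simp [I]
  obtain ⟨e⟩ := Cardinal.eq.1 hI
  refine ⟨I, inferInstance, inferInstance, fun i => (e i).1.1, fun i => (e i).1.2, ?_, ?_⟩
  · intro b hb
    obtain ⟨c, hc, hbc⟩ := hs ⟨b, hb⟩
    exact ⟨e.symm ⟨c, hc⟩, by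
      change b ∣ (e (e.symm ⟨c, hc⟩)).1.1
      rw [Equiv.apply_symm_apply]; exact hbc⟩
  · intro i b hb
    let b' : Set.Iio i → {r // r ∉ A} := fun j => ⟨b j, hb j j.2⟩
    have hnot : ¬IsCofinal (Set.range b') := by
      intro hcof
      have h1 := (Order.cof_le hcof).trans Cardinal.mk_range_le
      have h2 : #(Set.Iio i) < #I := Cardinal.mk_Iio_lt i (by simp [I])
      rw [hI, hcard] at h2
      exact absurd h2 (not_lt.2 h1)
    unfold IsCofinal at hnot
    push Not at hnot
    obtain ⟨c, hc⟩ := hnot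
    exact ⟨c.1, c.2, fun j hj => (hd _ _).resolve_right (hc (b' ⟨j, hj⟩) ⟨_, rfl⟩)⟩

end Transfinite

section Functional

variable {R : Type u} [CommRing R] {H : Type u} [AddCommGroup H] [Module R H]
  {hN : (nilradical R).IsPrime} {x₀ : H} {n : ℕ}

theorem IsCompactOver.exists_functional (hD : IsCompactOver R H x₀ n) (L : Ideal R)
    [hL : L.IsPrime] : ∃ f : H →ₗ[R] L.ResidueField, f x₀ = 1 ∧
      ∀ w ∈ satSubmodule H hN L, f w = 0 := by
  obtain ⟨x, hx⟩ := exists_indepMod (H := H) (hN := hN) (n := n) L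
  choose t ht c hc using hD.exists_smul_sub_mem hL hL le_rfl rfl hx
  set X := Fintype.linearCombination R x
  set φ := algebraMap R L.ResidueField
  have hφ : ∀ {r}, φ r = 0 ↔ r ∈ L := fun {r} => Ideal.algebraMap_residueField_eq_zero
  have key : ∀ h t' c', t' ∉ L → t' • h - X c' ∈ satSubmodule H hN L →
      ∀ i, φ (c h i) / φ (t h) = φ (c' i) / φ t' := by
    intro h t' c' ht' hc' i
    have h1 : X (t h • c' - t' • c h) ∈ satSubmodule H hN L := by
      rw [map_sub, map_smul, map_smul]
      have := Submodule.sub_mem _ (Submodule.smul_mem _ t' (hc h))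
        (Submodule.smul_mem _ (t h) hc')
      convert this using 1; module
    have h2 := hφ.2 (hx _ h1 i)
    rw [div_eq_div_iff (fun h0 => ht h (hφ.1 h0)) (fun h0 => ht' (hφ.1 h0))]
    simp only [Pi.sub_apply, Pi.smul_apply, smul_eq_mul, map_sub, map_mul] at h2
    linear_combination -h2
  have hne : ∀ h, φ (t h) ≠ 0 := fun h h0 => ht h (hφ.1 h0)
  let g (i) : H →ₗ[R] L.ResidueField :=
    { toFun := fun h => φ (c h i) / φ (t h)
      map_add' := fun h h' => by
        rw [key (h + h') (t h * t h') (t h' • c h + t h • c h')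
          (fun hm => (hL.mem_or_mem hm).elim (ht h) (ht h')) (by
            have := Submodule.add_mem _ (Submodule.smul_mem _ (t h') (hc h))
              (Submodule.smul_mem _ (t h) (hc h'))
            rw [map_add, map_smul, map_smul]
            convert this using 1; module) i]
        have := hne h
        have := hne h'
        simp only [Pi.add_apply, Pi.smul_apply, smul_eq_mul, map_add, map_mul]
        field_simp
      map_smul' := fun r h => by
        rw [key (r • h) (t h) (r • c h) (ht h) (by
          have := Submodule.smul_mem _ r (hc h)
          rw [map_smul]
          convert this using 1; module) i]
        simp only [Pi.smul_apply, smul_eq_mul, map_mul, RingHom.id_apply, Algebra.smul_def]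
        rw [mul_div_assoc] }
  have hex : ∃ i, c x₀ i ∉ L := by
    by_contra! hcon
    refine ht x₀ (hD.mem_of_smul_mem (hN := hN) hL ?_)
    have h1 : X (c x₀) ∈ satSubmodule H hN L := by
      rw [Fintype.linearCombination_apply]
      exact Submodule.sum_mem _ fun i _ => smul_mem_satSubmodule (hcon i) _
    simpa using Submodule.add_mem _ (hc x₀) h1
  obtain ⟨i, hi⟩ := hex
  have hgi : g i x₀ ≠ 0 := div_ne_zero (fun h0 => hi (hφ.1 h0)) (hne _)
  refine ⟨(g i x₀)⁻¹ • g i, ?_, fun w hw => ?_⟩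
  · rw [LinearMap.smul_apply, smul_eq_mul, inv_mul_cancel₀ hgi]
  · have : g i w = 0 := by
      change φ (c w i) / φ (t w) = 0
      rw [key w 1 0 (fun h => hL.ne_top ((Ideal.eq_top_iff_one _).2 h)) (by simpa using hw)]
      simp
    rw [LinearMap.smul_apply, this, smul_zero]

theorem exists_map_eq_or (hd : ∀ a b : R, a ∣ b ∨ b ∣ a) (L : Ideal R) [hL : L.IsPrime]
    (u v : L.ResidueField) : ∃ d, u = algebraMap R _ d * v ∨ v = algebraMap R _ d * u := by
  have hrep : ∀ u : L.ResidueField, ∃ a s, s ∉ L ∧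
      u = algebraMap R L.ResidueField a / algebraMap R L.ResidueField s := by
    intro u
    obtain ⟨u, rfl⟩ := IsLocalRing.residue_surjective u
    obtain ⟨⟨a, s⟩, h⟩ := IsLocalization.surj L.primeCompl u
    have hs : algebraMap R L.ResidueField s ≠ 0 := fun h0 =>
      s.2 (Ideal.algebraMap_residueField_eq_zero.1 h0)
    refine ⟨a, s, s.2, ?_⟩
    rw [eq_div_iff hs]
    exact congrArg (IsLocalRing.residue _) h |> fun h => by rw [map_mul] at h; exact h
  obtain ⟨a, s, hs, rfl⟩ := hrep u
  obtain ⟨b, t, ht, rfl⟩ := hrep v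
  have hs : algebraMap R L.ResidueField s ≠ 0 := fun h0 =>
    hs (Ideal.algebraMap_residueField_eq_zero.1 h0)
  have ht : algebraMap R L.ResidueField t ≠ 0 := fun h0 =>
    ht (Ideal.algebraMap_residueField_eq_zero.1 h0)
  rcases hd (a * t) (b * s) with ⟨d, h⟩ | ⟨d, h⟩
  · refine ⟨d, .inr ?_⟩
    have := congrArg (algebraMap R L.ResidueField) h
    simp only [map_mul] at this
    field_simp
    linear_combination this
  · refine ⟨d, .inl ?_⟩
    have := congrArg (algebraMap R L.ResidueField) h
    simp only [map_mul] at this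
    field_simp
    linear_combination this

theorem exists_top_of_total {K : Type v} [Field K] (φ : R →+* K)
    (h : ∀ u v : K, ∃ d, u = φ d * v ∨ v = φ d * u) {k : ℕ} (g : Fin k → K)
    (s : Finset (Fin k)) (hs : s.Nonempty) : ∃ i ∈ s, ∀ j ∈ s, ∃ d, g j = φ d * g i := by
  induction hs using Finset.Nonempty.cons_induction with
  | singleton a => exact ⟨a, by simp, fun j hj => ⟨1, by simp [Finset.mem_singleton.1 hj]⟩⟩
  | cons a s ha hs ih =>
    obtain ⟨i, hi, hij⟩ := ih
    obtain ⟨d, hd | hd⟩ := h (g a) (g i)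
    · refine ⟨i, by simp [hi], fun j hj => ?_⟩
      rcases Finset.mem_cons.1 hj with rfl | hj
      · exact ⟨d, hd⟩
      · exact hij j hj
    · refine ⟨a, by simp, fun j hj => ?_⟩
      rcases Finset.mem_cons.1 hj with rfl | hj
      · exact ⟨1, by simp⟩
      · obtain ⟨d', hd'⟩ := hij j hj
        exact ⟨d' * d, by rw [hd', hd, map_mul, mul_assoc]⟩

theorem IsCompactOver.exists_bound (hD : IsCompactOver R H x₀ n) {L₀ L : Ideal R}
    [hL₀ : L₀.IsPrime] (hL : L.IsPrime) (hle : L₀ ≤ L)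
    (hrk : indepRank H hN n L₀ = indepRank H hN n L) {f : H →ₗ[R] L₀.ResidueField}
    (hf1 : f x₀ = 1) (hfW : ∀ w ∈ satSubmodule H hN L₀, f w = 0) {q : R} (hq : q ∈ L)
    (hq0 : q ∉ L₀) : ∃ (v : R) (m : H),
      algebraMap R L₀.ResidueField v * f m = algebraMap R L₀.ResidueField q ∧
      ∀ h, ∃ d, algebraMap R L₀.ResidueField v * f h = algebraMap R L₀.ResidueField d := by
  obtain ⟨x, hx⟩ := exists_indepMod (H := H) (hN := hN) (n := n) L
  set φ := algebraMap R L₀.ResidueField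
  have hφq : φ q ≠ 0 := fun h0 => hq0 (Ideal.algebraMap_residueField_eq_zero.1 h0)
  obtain ⟨i, -, hi⟩ := exists_top_of_total φ (exists_map_eq_or hD.total L₀) (fun i => f (x i))
    Finset.univ ⟨⟨0, hD.indepRank_pos hL⟩, Finset.mem_univ _⟩
  choose e he using fun j => hi j (Finset.mem_univ j)
  have hh : ∀ h, ∃ d, φ q * f h = φ d * f (x i) := by
    intro h
    obtain ⟨t, ht, c, hc⟩ := hD.exists_smul_sub_mem hL₀ hL hle hrk hx h
    obtain ⟨q', rfl⟩ := dvd_of_mem_of_notMem hD.total ht hq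
    have h1 := hfW _ hc
    rw [map_sub, sub_eq_zero, map_smul, Fintype.linearCombination_apply, map_sum] at h1
    refine ⟨q' * ∑ j, c j * e j, ?_⟩
    rw [Algebra.smul_def] at h1
    have h2 : ∑ j, f (c j • x j) = φ (∑ j, c j * e j) * f (x i) := by
      rw [map_sum, Finset.sum_mul]
      refine Finset.sum_congr rfl fun j _ => ?_
      rw [map_smul, he j, Algebra.smul_def, map_mul, mul_assoc]
    rw [h2] at h1
    rw [map_mul, map_mul, mul_right_comm, h1]
    ring
  obtain ⟨v, hv⟩ := hh x₀
  rw [hf1, mul_one] at hv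
  have hμ : f (x i) ≠ 0 := fun h0 => hφq (by rw [hv, h0, mul_zero])
  refine ⟨v, x i, hv.symm, fun h => ?_⟩
  obtain ⟨d, hd⟩ := hh h
  refine ⟨d, mul_right_cancel₀ hμ ?_⟩
  rw [← hd, hv]; ring

end Functional

section Limit

variable {R : Type u} [CommRing R]

theorem ideal_le_total (hd : ∀ a b : R, a ∣ b ∨ b ∣ a) (I J : Ideal R) : I ≤ J ∨ J ≤ I := by
  by_contra! h
  obtain ⟨x, hx, hx'⟩ := SetLike.not_le_iff_exists.1 h.1
  obtain ⟨y, hy, hy'⟩ := SetLike.not_le_iff_exists.1 h.2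
  rcases hd x y with h | h
  · exact hy' (I.mem_of_dvd h hx)
  · exact hx' (J.mem_of_dvd h hy)

variable {H : Type u} [AddCommGroup H] [Module R H]
  {hN : (nilradical R).IsPrime} {x₀ : H} {n : ℕ}

theorem IsCompactOver.isSolvableAt_of_killed (hD : IsCompactOver R H x₀ n) {L₀ J A : Ideal R}
    [hL₀ : L₀.IsPrime] (hJ : J.IsPrime) (hL₀J : L₀ ≤ J) (hL₀A : L₀ ≤ A) (hA : IsGap J A)
    (hA1 : (1 : R) ∉ A)
    {f : H →ₗ[R] L₀.ResidueField} (hf1 : f x₀ = 1)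
    (hU : ∀ q ∈ J, q ∉ L₀ → ∃ (v : R) (m : H),
      algebraMap R L₀.ResidueField v * f m = algebraMap R L₀.ResidueField q ∧
      ∀ h, ∃ d, algebraMap R L₀.ResidueField v * f h = algebraMap R L₀.ResidueField d)
    (hK : ∀ q ∈ J, ∃ b, q * b ∈ A ∧ b ∉ A)
    (hsq : ∀ q ∈ J, ∃ t ∈ J, t * t ∣ q) : IsSolvableAt A := by
  intro a ha
  have hd := hD.total
  set φ := algebraMap R L₀.ResidueField
  have hφ : ∀ {r}, φ r = 0 ↔ r ∈ L₀ := fun {r} => Ideal.algebraMap_residueField_eq_zero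
  have hφd : ∀ {x c y}, c ∉ L₀ → φ x = φ (c * y) → c ∣ x := by
    intro x c y hc h
    have h1 : x - c * y ∈ L₀ := hφ.1 (by rw [map_sub, h, sub_self])
    simpa using dvd_add (dvd_of_mem_of_notMem hd hc h1) (Dvd.intro y rfl)
  have hfs : ∀ (c : R) (h : H), f (c • h) = φ c * f h := fun c h => by
    rw [map_smul, Algebra.smul_def]
  have hq : ∀ ρ : R, ρ ∉ A → ∃ q ∈ J, ρ * (q * q) ∉ A := by
    intro ρ hρ
    obtain ⟨q', hq', hρq⟩ := hA.exists_mul_notMem ρ hρ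
    obtain ⟨q, hq, hqq⟩ := hsq q' hq'
    exact ⟨q, hq, fun h => hρq (A.mem_of_dvd (mul_dvd_mul_left ρ hqq) h)⟩
  choose! Q hQJ hQA using hq
  have hQL : ∀ ρ ∉ A, Q ρ ∉ L₀ := fun ρ hρ h =>
    hQA ρ hρ (hL₀A (L₀.mul_mem_left _ (L₀.mul_mem_left _ h)))
  choose! v m hvm hvd using hU
  obtain ⟨I, _, _, β, hβA, hβ, hbd⟩ := exists_wellOrder_cofinal hd A
  obtain ⟨ρ, hρP, hρr⟩ := exists_transfinite_sequence (I := I) (X := R)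
    (fun i ρ => ρ ∉ A ∧ β i ∣ ρ) (fun _ _ ρ ρ' => ρ * (Q ρ * Q ρ) ∣ ρ') (by
      intro i h hP _
      obtain ⟨c, hc, hcd⟩ := hbd i (fun j => h j * (Q (h j) * Q (h j)))
        fun j hj => hQA _ (hP j hj).1
      rcases hd c (β i) with h1 | h1
      · exact ⟨β i, ⟨hβA i, dvd_rfl⟩, fun j hj => (hcd j hj).trans h1⟩
      · exact ⟨c, ⟨hc, h1⟩, hcd⟩)
  have hρA := fun i => (hρP i).1
  have hρL : ∀ i, ρ i ∉ L₀ := fun i h => hρA i (hL₀A h)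
  set q := fun i => Q (ρ i) with hqdef
  have hqJ : ∀ i, q i ∈ J := fun i => hQJ _ (hρA i)
  have hqL : ∀ i, q i ∉ L₀ := fun i => hQL _ (hρA i)
  set V := fun i => v (q i)
  set M := fun i => m (q i)
  have hVM : ∀ i, φ (V i) * f (M i) = φ (q i) := fun i => hvm _ (hqJ i) (hqL i)
  have hVd : ∀ i h, ∃ d, φ (V i) * f h = φ d := fun i => hvd _ (hqJ i) (hqL i)
  have hVL : ∀ i, V i ∉ L₀ := fun i h => hqL i (hφ.1 (by rw [← hVM, hφ.2 h, zero_mul]))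
  set σ := fun i => ρ i * V i with hσdef
  have hσL : ∀ i, σ i ∉ L₀ := fun i h => (hL₀.mem_or_mem h).elim (hρL i) (hVL i)
  have e1 : ∀ i, φ (ρ i * (q i * q i)) = φ (q i * σ i) * f (M i) := by
    intro i
    simp only [hσdef, map_mul]
    linear_combination -(φ (ρ i) * φ (q i)) * hVM i
  have e2 : ∀ i j, V j ∣ V i * q j := by
    intro i j
    obtain ⟨d, hd'⟩ := hVd i (M j)
    refine hφd (y := d) (hVL j) ?_
    rw [map_mul, map_mul, ← hd', ← hVM j]; ring
  have e3 : ∀ j i, j < i → q j * σ j ∣ σ i := by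
    intro j i hji
    have h1 : q j * σ j ∣ ρ j * q j * (V i * q j) := by
      have := mul_dvd_mul_left (ρ j * q j) (e2 i j)
      convert this using 1; simp only [hσdef]; ring
    have h2 := mul_dvd_mul_right (hρr i j hji) (V i)
    refine h1.trans ?_
    convert h2 using 1; ring
  have e4 : ∀ j j', σ j ∣ σ j' → j ≤ j' := by
    intro j j' h
    by_contra! hlt
    obtain ⟨u, hu⟩ := (e3 _ _ hlt).trans h
    have h1 : σ j' * (1 - q j' * u) ∈ L₀ := by
      have : σ j' * (1 - q j' * u) = 0 := by linear_combination hu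
      rw [this]; exact zero_mem _
    have h2 := hL₀J ((hL₀.mem_or_mem h1).resolve_left (hσL _))
    refine hJ.ne_top ((Ideal.eq_top_iff_one _).2 ?_)
    simpa using J.add_mem h2 (J.mul_mem_right u (hqJ j'))
  set a' := fun i => a (ρ i * (q i * q i))
  have ha' : ∀ j i, j < i → ∃ w : R, φ (a' i) - φ (a' j) = φ (q j * σ j) * f (w • M j) := by
    intro j i hji
    obtain ⟨w, hw⟩ := ha _ (hQA _ (hρA j)) _ (hQA _ (hρA i)) ((hρr i j hji).trans
      (Dvd.intro _ rfl))
    refine ⟨w, ?_⟩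
    have h1 : φ (a' i) - φ (a' j) = φ (ρ j * (q j * q j)) * φ w := by
      rw [← map_sub, ← map_mul]; exact congrArg φ hw
    rw [h1, e1, hfs]; ring
  obtain ⟨h, hhP, hhr⟩ := exists_transfinite_sequence (I := I) (X := H)
    (fun i x => f x = φ (a' i)) (fun j _ x y => ∃ w, y - x = σ j • w) (by
      intro i h hP hr
      by_cases hemp : ∀ j, ¬j < i
      · exact ⟨a' i • x₀, by rw [hfs, hf1, mul_one], fun j hj => (hemp j hj).elim⟩
      push Not at hemp
      obtain ⟨j0, hj0⟩ := hemp
      obtain ⟨h', hA', hB'⟩ : ∃ h', (∀ j < i, ∃ w, h' - h j = σ j • w) ∧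
          ∀ j < i, ∃ w, φ (a' i) - f h' = φ (q j * σ j) * f w := by
        by_cases hmax : ∃ k < i, ∀ j < i, j ≤ k
        · obtain ⟨k, hk, hkm⟩ := hmax
          refine ⟨h k, fun j hj => ?_, fun j hj => ?_⟩
          · rcases (hkm j hj).lt_or_eq with hlt | rfl
            · exact hr k hk j hlt
            · exact ⟨0, by simp⟩
          · obtain ⟨w, hw⟩ := ha' k i hk
            obtain ⟨e, he⟩ : q j * σ j ∣ q k * σ k := by
              rcases (hkm j hj).lt_or_eq with hlt | rfl
              · exact (e3 j k hlt).mul_left _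
              · exact dvd_rfl
            refine ⟨e • w • M k, ?_⟩
            rw [hP k hk, hw, he, hfs e, map_mul φ _ e]; ring
        · push Not at hmax
          obtain ⟨z, hz⟩ := hD.limit (J := {j // j < i}) (fun j => σ j.1) (fun j => h j.1) (by
            intro j j' hjj
            rcases (e4 _ _ hjj).lt_or_eq with hlt | heq
            · exact hr _ j'.2 _ hlt
            · exact ⟨0, by rw [heq]; simp⟩)
          refine ⟨z, fun j hj => hz ⟨j, hj⟩, fun j hj => ?_⟩
          obtain ⟨k, hk, hjk⟩ := hmax j hj
          obtain ⟨w, hw⟩ := hz ⟨k, hk⟩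
          obtain ⟨w', hw'⟩ := ha' k i hk
          obtain ⟨e, he⟩ := e3 j k hjk
          have h1 := congrArg f hw
          rw [map_sub, hfs, hP k hk] at h1
          refine ⟨e • (q k • w' • M k - w), ?_⟩
          rw [hfs e, map_sub, hfs (q k), ← mul_assoc, ← map_mul φ _ e, ← he]
          rw [map_mul] at hw'
          simp only at h1
          linear_combination hw' - h1
      choose! b hbA hbnA using hK
      obtain ⟨c, hc, hcb⟩ := hbd i (fun j => b (q j)) fun j _ => hbnA _ (hqJ j)
      obtain ⟨s, hsJ, hcs⟩ := hA.exists_mul_notMem c hc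
      have hsL : s ∉ L₀ := fun hs => hcs (hL₀A (L₀.mul_mem_left _ hs))
      have hsq' : ∀ j < i, s ∣ q j := fun j hj => by
        refine (hd _ _).resolve_right fun hqs => hcs (A.mem_of_dvd ?_ (hbA _ (hqJ j)))
        rw [mul_comm c]
        exact mul_dvd_mul hqs (hcb j hj)
      have hsm := hvm s hsJ hsL
      have hms : f (m s) ≠ 0 := fun h0 => hsL (hφ.1 (by rw [← hsm, h0, mul_zero]))
      have hcj : ∀ j < i, ∃ e, φ (a' i) - f h' = φ (σ j * e) * f (m s) := by
        intro j hj
        obtain ⟨w, hw⟩ := hB' j hj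
        obtain ⟨t, ht⟩ := hsq' j hj
        obtain ⟨d, hd'⟩ := hvd s hsJ hsL w
        refine ⟨t * d, ?_⟩
        rw [hw, ht]
        simp only [map_mul]
        rw [← hd', ← hsm]; ring
      obtain ⟨e, he⟩ := hcj j0 hj0
      refine ⟨h' + (σ j0 * e) • m s, ?_, fun j hj => ?_⟩
      · rw [map_add, hfs, ← he]; ring
      · obtain ⟨w, hw⟩ := hA' j hj
        obtain ⟨e', he'⟩ := hcj j hj
        obtain ⟨t, ht⟩ := hφd (hσL j) (mul_right_cancel₀ hms (he.symm.trans he'))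
        exact ⟨w + t • m s, by rw [add_sub_right_comm, hw, ht]; module⟩)
  obtain ⟨z, hz⟩ := hD.limit σ h (by
    intro j j' hjj
    rcases (e4 _ _ hjj).lt_or_eq with hlt | heq
    · exact hhr _ _ hlt
    · exact ⟨0, by rw [heq]; simp⟩)
  have hzi : ∀ i, ∃ d, f z = φ (a' i + ρ i * d) := by
    intro i
    obtain ⟨w, hw⟩ := hz i
    obtain ⟨d, hd'⟩ := hVd i w
    have h1 := congrArg f hw
    rw [map_sub, hfs, hhP, map_mul] at h1
    exact ⟨d, by rw [map_add, map_mul, ← hd']; linear_combination h1⟩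
  obtain ⟨i0, -⟩ := hβ 1 hA1
  obtain ⟨d0, hd0⟩ := hzi i0
  refine ⟨a' i0 + ρ i0 * d0, fun r hr => ?_⟩
  obtain ⟨i, hi⟩ := hβ r hr
  have hri : r ∣ ρ i := hi.trans (hρP i).2
  obtain ⟨d, hd'⟩ := hzi i
  have h1 : ρ i ∣ a' i0 + ρ i0 * d0 - a' i := by
    refine hφd (y := d) (hρL i) ?_
    rw [map_sub, ← hd0, hd', map_add]; ring
  have h2 := ha r hr _ (hQA _ (hρA i)) (hri.trans (Dvd.intro _ rfl))
  have h3 : r ∣ (a' i0 + ρ i0 * d0 - a' i) + (a' i - a r) := dvd_add (hri.trans h1) h2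
  rwa [sub_add_sub_cancel] at h3

theorem IsCompactOver.isSolvableAbove_of_limit (hD : IsCompactOver R H x₀ n) {L₀ J : Ideal R}
    (hL₀ : L₀.IsPrime) (hJ : J.IsPrime) (hlt : L₀ < J)
    (hlim : ∀ q ∈ J, ∃ L : Ideal R, L.IsPrime ∧ L < J ∧ q ∈ L)
    (hrk : ∀ L : Ideal R, L.IsPrime → L₀ ≤ L → L < J →
      indepRank H hN n L₀ = indepRank H hN n L) : IsSolvableAbove L₀ J := by
  intro A hLA hA
  have hd := hD.total
  by_cases hA1 : (1 : R) ∈ A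
  · exact .of_one_mem hA1
  by_cases hcase : ∃ q ∈ J, ∀ b, q * b ∈ A → b ∈ A
  · obtain ⟨q, hqJ, hq⟩ := hcase
    obtain ⟨L, hL, hLJ, hqL⟩ := hlim q hqJ
    have hle : L₀ ≤ L := (ideal_le_total hd _ _).resolve_right fun h =>
      hA1 (hq 1 (by rw [mul_one]; exact hLA.le (h hqL)))
    refine hD.isSolvableAbove_of_eq hL₀ hL hle (hrk L hL hle hLJ) A hLA ⟨?_, ?_⟩
    · intro s hs b hb
      obtain ⟨u, rfl⟩ := dvd_of_mem_of_notMem hd hs hqL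
      refine hq b ?_
      rw [mul_right_comm]; exact A.mul_mem_right u hb
    · exact fun r hr => ⟨q, hqL, fun h => hr (hq r (by rwa [mul_comm]))⟩
  push Not at hcase
  obtain ⟨f, hf1, hfW⟩ := hD.exists_functional (hN := hN) L₀
  refine hD.isSolvableAt_of_killed hJ hlt.le hLA.le hA hA1 hf1 ?_ hcase ?_
  · intro q hq hq0
    obtain ⟨L, hL, hLJ, hqL⟩ := hlim q hq
    have hle : L₀ ≤ L := (ideal_le_total hd _ _).resolve_right fun h => hq0 (h hqL)
    exact hD.exists_bound hL hle (hrk L hL hle hLJ) hf1 hfW hqL hq0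
  · intro q hq
    obtain ⟨L, hL, hLJ, hqL⟩ := hlim q hq
    obtain ⟨t, ht, htL⟩ := SetLike.exists_of_lt hLJ
    exact ⟨t, ht, dvd_of_mem_of_notMem hd (fun h => (hL.mem_or_mem h).elim htL htL) hqL⟩

end Limit

section Chain

variable {R : Type u} [CommRing R]

/-- The intersection of the ideals generated by the powers of `p`. -/
def powInf (p : R) : Ideal R := ⨅ k : ℕ, Ideal.span {p ^ k}

theorem mem_powInf {p x : R} : x ∈ powInf p ↔ ∀ k, p ^ k ∣ x := by
  simp [powInf, Ideal.mem_span_singleton]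

theorem not_pow_succ_dvd (hN : (nilradical R).IsPrime) {J : Ideal R} [hJ : J.IsPrime] {p : R}
    (hp : p ∈ J) (hpN : p ∉ nilradical R) (k : ℕ) : ¬p ^ (k + 1) ∣ p ^ k := by
  rintro ⟨u, hu⟩
  have h1 : p ^ k * (1 - p * u) ∈ nilradical R := by
    have : p ^ k * (1 - p * u) = 0 := by linear_combination hu
    rw [this]; exact zero_mem _
  have h2 := nilradical_le_prime J
    ((hN.mem_or_mem h1).resolve_left fun h => hpN (hN.mem_of_pow_mem _ h))
  refine hJ.ne_top ((Ideal.eq_top_iff_one _).2 ?_)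
  simpa using J.add_mem h2 (J.mul_mem_right u hp)

theorem isPrime_powInf (hd : ∀ a b : R, a ∣ b ∨ b ∣ a) (hN : (nilradical R).IsPrime) {J : Ideal R}
    [hJ : J.IsPrime] {p : R} (hp : p ∈ J) (hpN : p ∉ nilradical R) :
    (powInf p).IsPrime ∧ powInf p < J := by
  have hlt : powInf p < J := by
    refine lt_of_le_of_ne (fun x hx => ?_) fun h => ?_
    · exact J.mem_of_dvd (by simpa using mem_powInf.1 hx 1) hp
    · exact not_pow_succ_dvd hN hp hpN 1 (by simpa using mem_powInf.1 (h ▸ hp) 2)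
  refine ⟨⟨(hlt.trans_le le_top).ne, fun {x y} hxy => ?_⟩, hlt⟩
  by_contra! hcon
  simp only [mem_powInf, not_forall] at hcon hxy
  obtain ⟨⟨k, hk⟩, m, hm⟩ := hcon
  refine not_pow_succ_dvd hN hp hpN (k + m) ((hxy _).trans ?_)
  rw [pow_add]
  exact mul_dvd_mul ((hd _ _).resolve_left hk) ((hd _ _).resolve_left hm)

variable {H : Type u} [AddCommGroup H] [Module R H]
  {hN : (nilradical R).IsPrime} {x₀ : H} {n : ℕ}

theorem IsCompactOver.isSolvableAt_nilradical [IsLocalRing R] (hD : IsCompactOver R H x₀ n)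
    (A : Ideal R) (hA : IsGap (nilradical R) A) : IsSolvableAt A :=
  hA.isSolvableAt hD (isPrime_nilradical_of_total hD.total).ne_top
    fun _ ⟨k, hk⟩ => ⟨k, by rw [hk]; exact zero_mem _⟩

theorem IsCompactOver.exists_isSolvableAbove [IsLocalRing R] (hD : IsCompactOver R H x₀ n)
    {J : Ideal R} [hJ : J.IsPrime] (hNJ : nilradical R < J) :
    ∃ L : Ideal R, L.IsPrime ∧ L < J ∧ IsSolvableAbove L J := by
  have hd := hD.total
  have hN := isPrime_nilradical_of_total hd
  by_cases hlim : ∀ q ∈ J, ∃ L : Ideal R, L.IsPrime ∧ L < J ∧ q ∈ L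
  · set S : Set (Ideal R) := {L | L.IsPrime ∧ L < J}
    have hne : S.Nonempty := ⟨_, hN, hNJ⟩
    have hmin := fun L (hL : L ∈ S) => Function.argminOn_le (indepRank H hN n) S hL
    obtain ⟨hL, hLJ⟩ := Function.argminOn_mem (indepRank H hN n) S hne
    exact ⟨_, hL, hLJ, hD.isSolvableAbove_of_limit hL hJ hLJ hlim fun L' hL' hle hlt =>
      (hmin L' ⟨hL', hlt⟩).antisymm (hD.indepRank_anti hL hL'.ne_top hle)⟩
  · push Not at hlim
    obtain ⟨q, hqJ, hq⟩ := hlim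
    obtain ⟨hL, hLJ⟩ := isPrime_powInf hd hN hqJ (hq _ hN hNJ)
    refine ⟨_, hL, hLJ, fun A hA hgap => hgap.isSolvableAt hD hJ.ne_top fun p hp => ?_⟩
    by_cases hpN : p ∈ nilradical R
    · obtain ⟨k, hk⟩ := hpN
      exact ⟨k, by rw [hk]; exact zero_mem _⟩
    obtain ⟨a, haA, ha⟩ := SetLike.exists_of_lt hA
    simp only [mem_powInf, not_forall] at ha
    obtain ⟨m, hm⟩ := ha
    obtain ⟨hLp, hLpJ⟩ := isPrime_powInf hd hN hp hpN
    have hqp := hq _ hLp hLpJ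
    simp only [mem_powInf, not_forall] at hqp
    obtain ⟨k, hk⟩ := hqp
    refine ⟨k * m, A.mem_of_dvd ?_ haA⟩
    rw [pow_mul]
    exact ((hd _ _).resolve_left hm).trans (pow_dvd_pow_of_dvd ((hd _ _).resolve_left hk) m)

/-- A finite descending chain of primes from `J` whose steps, as well as the last member, satisfy
the solvability conditions. -/
def HasSolvableChain (J : Ideal R) : Prop :=
  ∃ (m : ℕ) (L : Fin (m + 1) → Ideal R), (∀ i, (L i).IsPrime) ∧ L 0 = J ∧ StrictAnti L ∧
    (∀ k : Fin m, IsSolvableAbove (L k.succ) (L k.castSucc)) ∧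
    ∀ A, IsGap (L (Fin.last m)) A → IsSolvableAt A

theorem HasSolvableChain.cons {L J : Ideal R} (hL : HasSolvableChain L) (hJ : J.IsPrime)
    (hlt : L < J) (hLJ : IsSolvableAbove L J) : HasSolvableChain J := by
  obtain ⟨m, F, hF, h0, hanti, hs, hlast⟩ := hL
  refine ⟨m + 1, Fin.cons J F, Fin.cases hJ hF, rfl, ?_, ?_, hlast⟩
  · rw [Fin.strictAnti_iff_succ_lt]
    refine Fin.cases ?_ fun i => ?_
    · simpa [h0] using hlt
    · rw [← Fin.succ_castSucc]
      simpa using hanti (Fin.castSucc_lt_succ (i := i))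
  · refine Fin.cases ?_ fun i => ?_
    · simpa [h0] using hLJ
    · rw [← Fin.succ_castSucc]
      simpa using hs i

theorem IsCompactOver.hasSolvableChain [IsLocalRing R] (hD : IsCompactOver R H x₀ n)
    {J : Ideal R} (hJ : J.IsPrime) : HasSolvableChain J := by
  have hd := hD.total
  have hN := isPrime_nilradical_of_total hd
  induction hk : n - indepRank H hN n J using Nat.strong_induction_on generalizing J with
  | _ k ih =>
  have hih : ∀ L : Ideal R, L.IsPrime → indepRank H hN n J < indepRank H hN n L →
      HasSolvableChain L := fun L hL hlt =>
    ih (n - indepRank H hN n L)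
      (by have := indepRank_le (H := H) (hN := hN) (n := n) L; omega) hL rfl
  set T : Set (Ideal R) :=
    {L | L.IsPrime ∧ L ≤ J ∧ indepRank H hN n L = indepRank H hN n J} with hT
  have hJT : J ∈ T := ⟨hJ, le_rfl, rfl⟩
  have hTp : (sInf T).IsPrime := Ideal.sInf_isPrime_of_isChain ⟨J, hJT⟩
    (fun L _ L' _ _ => ideal_le_total hd L L') fun L hL => hL.1
  have hTJ : sInf T ≤ J := sInf_le hJT
  have hTs : IsSolvableAbove (sInf T) J := by
    intro A hA
    obtain ⟨L, hL, hLA⟩ : ∃ L ∈ T, L < A := by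
      by_contra! hcon
      refine hA.not_ge (le_sInf fun L hL => ?_)
      rcases ideal_le_total hd A L with h | h
      · exact h
      · exact (h.eq_of_not_lt (hcon L hL)).ge
    exact hD.isSolvableAbove_of_eq hL.1 hJ hL.2.1 hL.2.2 A hLA
  have hfin : HasSolvableChain (sInf T) → HasSolvableChain J := fun h => by
    rcases hTJ.lt_or_eq with hlt | heq
    · exact h.cons hJ hlt hTs
    · rwa [heq] at h
  refine hfin ?_
  by_cases hrk : indepRank H hN n J < indepRank H hN n (sInf T)
  · exact hih _ hTp hrk
  rcases (nilradical_le_prime (sInf T)).lt_or_eq with hlt | heq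
  · obtain ⟨L, hL, hLT, hs⟩ := hD.exists_isSolvableAbove hlt
    refine (hih L hL ?_).cons hTp hLT hs
    have h1 := hD.indepRank_anti (hN := hN) hL hJ.ne_top (hLT.le.trans hTJ)
    refine lt_of_le_of_ne h1 fun h => hLT.not_ge (sInf_le ⟨hL, hLT.le.trans hTJ, h.symm⟩)
  · rw [← heq]
    refine ⟨0, fun _ => nilradical R, fun _ => hN, rfl, fun i j h => by omega,
      fun k => k.elim0, fun A hA => hD.isSolvableAt_nilradical A hA⟩

end Chain

section Translation

theorem exists_solution_of_isSolvableAt {R : Type u} [CommRing R] {R' : Type v} [CommRing R']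
    (hd : ∀ a b : R, a ∣ b ∨ b ∣ a) {J : Ideal R} (φ : R →+* R')
    (hu : ∀ t ∉ J, IsUnit (φ t)) (hs : ∀ y, ∃ t ∉ J, ∃ b, φ t * y = φ b)
    {κ : Type*} (a : κ → R') (A : κ → Ideal R')
    (hfin : ∀ s : Finset κ, ∃ x, ∀ i ∈ s, x - a i ∈ A i)
    (hsol : IsGap J ((⨅ i, A i).comap φ) → IsSolvableAt ((⨅ i, A i).comap φ)) :
    ∃ x, ∀ i, x - a i ∈ A i := by
  classical
  have hrep : ∀ y, ∃ b, Associated y (φ b) := by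
    intro y
    obtain ⟨t, ht, b, hb⟩ := hs y
    obtain ⟨u, hu⟩ := hu t ht
    exact ⟨b, u, by rw [hu, mul_comm, hb]⟩
  have hd' : ∀ y z : R', y ∣ z ∨ z ∣ y := by
    intro y z
    obtain ⟨b, hb⟩ := hrep y
    obtain ⟨c, hc⟩ := hrep z
    rw [hb.dvd_iff_dvd_left, hc.dvd_iff_dvd_right, hc.dvd_iff_dvd_left, hb.dvd_iff_dvd_right]
    exact (hd b c).imp (map_dvd φ) (map_dvd φ)
  have hcompat : ∀ i j, A i ≤ A j → a i - a j ∈ A j := by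
    intro i j hij
    obtain ⟨x, hx⟩ := hfin {i, j}
    have h1 := (A j).sub_mem (hx j (by simp)) (hij (hx i (by simp)))
    simpa using h1
  rcases isEmpty_or_nonempty κ with hκ | ⟨⟨k0⟩⟩
  · exact ⟨0, fun i => isEmptyElim i⟩
  by_cases hmin : ∃ i, ∀ j, A i ≤ A j
  · obtain ⟨i, hi⟩ := hmin
    exact ⟨a i, fun j => hcompat i j (hi j)⟩
  push Not at hmin
  have hbetween : ∀ i, ∃ r k, φ r ∈ A i ∧ φ r ∉ A k := by
    intro i
    obtain ⟨k, hk⟩ := hmin i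
    obtain ⟨y, hy, hyk⟩ := SetLike.not_le_iff_exists.1 hk
    obtain ⟨b, hb⟩ := hrep y
    exact ⟨b, k, (A i).mem_of_dvd hb.dvd hy, fun h => hyk ((A k).mem_of_dvd hb.symm.dvd h)⟩
  set B := (⨅ i, A i).comap φ with hBdef
  have hB : ∀ {r}, r ∈ B ↔ ∀ i, φ r ∈ A i := fun {r} => by
    simp [hBdef, Ideal.mem_comap, Submodule.mem_iInf]
  have hgap : IsGap J B := by
    refine ⟨fun s hs b hb => hB.2 fun i => ?_, fun r hr => ?_⟩
    · have h1 := hB.1 hb i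
      rw [map_mul] at h1
      exact (Ideal.unit_mul_mem_iff_mem _ (hu s hs)).1 h1
    · rw [hB] at hr
      push Not at hr
      obtain ⟨i, hi⟩ := hr
      obtain ⟨b, k, hbi, hbk⟩ := hbetween i
      obtain ⟨q, rfl⟩ := (hd r b).resolve_right fun h => hi ((A i).mem_of_dvd (map_dvd φ h) hbi)
      refine ⟨q, ?_, fun h => hbk (hB.1 h k)⟩
      by_contra hq
      rw [map_mul, mul_comm] at hbi
      exact hi ((Ideal.unit_mul_mem_iff_mem _ (hu q hq)).1 hbi)
  have hker : ∀ {x}, φ x = 0 → x ∈ B := fun hx => hB.2 fun i => by rw [hx]; exact zero_mem _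
  have hkey : ∀ {r q x}, r ∉ B → q ∈ J → r * q ∉ B → φ (r * q) ∣ φ x → r ∣ x := by
    rintro r q x hr hq hrq ⟨y, hy⟩
    obtain ⟨t, ht, b, hb⟩ := hs y
    have h1 : t * x - r * q * b ∈ B := hker (by
      rw [map_sub, map_mul, map_mul φ (r * q), ← hb, hy]; ring)
    obtain ⟨w, hw⟩ : r * q ∣ t * x := by
      simpa using dvd_add (dvd_of_mem_of_notMem hd hrq h1) (Dvd.intro b rfl)
    obtain ⟨q', rfl⟩ := dvd_of_mem_of_notMem hd ht hq
    have h2 : x - r * q' * w ∈ B := hgap.mem_of_mul_mem t ht _ (by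
      have : t * (x - r * q' * w) = 0 := by linear_combination hw
      rw [this]; exact zero_mem _)
    have h3 : r ∣ r * q' * w := ⟨q' * w, by ring⟩
    simpa using dvd_add (dvd_of_mem_of_notMem hd hr h2) h3
  have hpr : ∀ {r i}, φ r ∉ A i → ∀ y ∈ A i, φ r ∣ y := fun {r i} hr y hy =>
    dvd_of_mem_of_notMem hd' hr hy
  obtain ⟨r0, i0, -, hi0⟩ := hbetween k0
  have hlift : ∀ i, A i ≤ A i0 → ∃ c, a i - a i0 = φ c := by
    intro i hi
    have h1 := hcompat i i0 hi
    obtain ⟨t, ht, b, hb⟩ := hs (a i - a i0)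
    have hbJ : b ∈ J := by
      by_contra hbJ
      have h2 : φ b ∈ A i0 := hb ▸ (A i0).mul_mem_left _ h1
      exact hi0 ((A i0).eq_top_of_isUnit_mem h2 (hu b hbJ) ▸ Submodule.mem_top)
    obtain ⟨c, rfl⟩ := dvd_of_mem_of_notMem hd ht hbJ
    exact ⟨c, (hu t ht).mul_left_cancel (by rw [hb, map_mul])⟩
  have hchoice : ∀ r ∉ B, ∃ q ∈ J, r * q ∉ B ∧ ∃ i, φ (r * q) ∉ A i ∧ ∃ c, a i - a i0 = φ c := by
    intro r hr
    obtain ⟨q, hq, hrq⟩ := hgap.exists_mul_notMem r hr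
    have h1 := hrq
    rw [hB] at h1
    push Not at h1
    obtain ⟨i, hi⟩ := h1
    rcases ideal_le_total hd' (A i) (A i0) with h | h
    · exact ⟨q, hq, hrq, i, hi, hlift i h⟩
    · exact ⟨q, hq, hrq, i0, fun h' => hi (h h'), hlift i0 le_rfl⟩
  have : Nonempty κ := ⟨i0⟩
  choose! q hqJ hqB i hi c hc using hchoice
  obtain ⟨b, hb⟩ := hsol hgap c (by
    intro r hr r' hr' hrr
    have h1 : φ (c r' - c r) = a (i r') - a (i r) := by
      rw [map_sub, ← hc r hr, ← hc r' hr']; ring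
    rcases ideal_le_total hd' (A (i r')) (A (i r)) with h | h
    · refine hkey hr (hqJ r hr) (hqB r hr) ?_
      rw [h1]
      exact hpr (hi r hr) _ (hcompat _ _ h)
    · refine hrr.trans (hkey hr' (hqJ r' hr') (hqB r' hr') ?_)
      rw [h1, ← neg_sub]
      exact (dvd_neg).2 (hpr (hi r' hr') _ (hcompat _ _ h)))
  refine ⟨a i0 + φ b, fun j => ?_⟩
  obtain ⟨r, k, hrj, hrk⟩ := hbetween j
  have hr : r ∉ B := fun h => hrk (hB.1 h k)
  have h1 : A (i r) ≤ A j := fun y hy =>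
    (A j).mem_of_dvd ((map_dvd φ (Dvd.intro (q r) rfl)).trans (hpr (hi r hr) y hy)) hrj
  have h2 : a i0 + φ b - a j = φ (b - c r) + (a (i r) - a j) := by
    rw [map_sub, ← hc r hr]; ring
  rw [h2]
  exact (A j).add_mem ((A j).mem_of_dvd (map_dvd φ (hb r hr)) hrj) (hcompat _ _ h1)

theorem isMaximalCR_localization {R : Type u} [CommRing R] (hd : ∀ a b : R, a ∣ b ∨ b ∣ a)
    (J : Ideal R) [J.IsPrime] (hJ : ∀ A, IsGap J A → IsSolvableAt A) :
    IsMaximalCR (Localization.AtPrime J) := by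
  intro κ a A hfin
  refine exists_solution_of_isSolvableAt hd (algebraMap R (Localization.AtPrime J))
    (fun t ht => IsLocalization.map_units _ (⟨t, ht⟩ : J.primeCompl)) (fun y => ?_) a A hfin
    (hJ _)
  obtain ⟨⟨b, t⟩, h⟩ := IsLocalization.surj J.primeCompl y
  exact ⟨t, t.2, b, by rw [mul_comm]; exact h⟩

theorem isAlmostMaximalCR_localization {R : Type u} [CommRing R]
    (hd : ∀ a b : R, a ∣ b ∨ b ∣ a) {L J : Ideal R} (hLJ : L ≤ J)
    (hp : (J.map (Ideal.Quotient.mk L)).IsPrime) (hJ : IsSolvableAbove L J) :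
    IsAlmostMaximalCR (Localization.AtPrime (J.map (Ideal.Quotient.mk L))) := by
  set π := Ideal.Quotient.mk L
  set S := Localization.AtPrime (J.map π)
  intro κ a A hne hfin
  have hmem : ∀ t ∉ J, π t ∉ J.map π := fun t ht h => ht <| by
    rw [← Ideal.mem_comap, Ideal.comap_map_of_surjective π Ideal.Quotient.mk_surjective] at h
    rwa [← RingHom.ker_eq_comap_bot, Ideal.mk_ker, sup_eq_left.2 hLJ] at h
  set φ := (algebraMap (R ⧸ L) S).comp π
  have hu : ∀ t ∉ J, IsUnit (φ t) := fun t ht =>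
    IsLocalization.map_units S (⟨π t, hmem t ht⟩ : (J.map π).primeCompl)
  have hs : ∀ y, ∃ t ∉ J, ∃ b, φ t * y = φ b := fun y => by
    obtain ⟨⟨b, t, ht⟩, h⟩ := IsLocalization.surj (J.map π).primeCompl y
    obtain ⟨b, rfl⟩ := Ideal.Quotient.mk_surjective b
    obtain ⟨t, rfl⟩ := Ideal.Quotient.mk_surjective t
    exact ⟨t, fun htJ => ht (Ideal.mem_map_of_mem _ htJ), b, by rw [mul_comm]; exact h⟩
  refine exists_solution_of_isSolvableAt hd φ hu hs a A hfin
    (hJ _ (lt_of_le_of_ne (fun x hx => ?_) fun h => hne ?_))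
  · have : φ x = 0 := by
      change algebraMap (R ⧸ L) S (π x) = 0
      rw [Ideal.Quotient.eq_zero_iff_mem.2 hx, map_zero]
    rw [Ideal.mem_comap, this]; exact zero_mem _
  · refine (Submodule.eq_bot_iff _).2 fun y hy => ?_
    obtain ⟨t, ht, b, hb⟩ := hs y
    have h1 : b ∈ (⨅ i, A i).comap φ := by
      rw [Ideal.mem_comap, ← hb]; exact Ideal.mul_mem_left _ _ hy
    rw [← h] at h1
    refine (hu t ht).mul_right_eq_zero.1 ?_
    rw [hb]
    change algebraMap (R ⧸ L) S (π b) = 0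
    rw [Ideal.Quotient.eq_zero_iff_mem.2 h1, map_zero]

end Translation

/-- if a pure-injective hull `H` of a chain ring `R` has finite Malcev rank, then
there is a finite strictly descending chain of prime ideals
`P = L 0 ⊃ L 1 ⊃ … ⊃ L m ⊇ nilradical R` such that each `(R/L (k+1))_{L k}` is almost maximal
and `R_{L m}` is maximal. -/
theorem stmt16 (R : Type u) [CommRing R] [IsLocalRing R]
    (hchain : ∀ I J : Ideal R, I ≤ J ∨ J ≤ I)
    (H : Type u) [AddCommGroup H] [Module R H]
    (ι : R →ₗ[R] H) (hι : Function.Injective ι)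
    (hpi : IsPureInjective R H)
    (hess : IsPureEssentialExtension R (LinearMap.range ι))
    (hmr : ∃ k : ℕ, MalcevRankLE R H k) :
    ∃ (m : ℕ) (L : Fin (m + 1) → Ideal R),
      (∀ i, (L i).IsPrime) ∧
      L 0 = IsLocalRing.maximalIdeal R ∧
      StrictAnti L ∧
      nilradical R ≤ L (Fin.last m) ∧
      (∀ k : Fin m,
        ∃ hp : (Ideal.map (Ideal.Quotient.mk (L k.succ)) (L k.castSucc)).IsPrime,
          letI := hp
          IsAlmostMaximalCR
            (Localization.AtPrime (Ideal.map (Ideal.Quotient.mk (L k.succ)) (L k.castSucc)))) ∧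
      (∃ hp : (L (Fin.last m)).IsPrime,
        letI := hp
        IsMaximalCR (Localization.AtPrime (L (Fin.last m)))) := by
  obtain ⟨n, hn⟩ := hmr
  have hd : ∀ a b : R, a ∣ b ∨ b ∣ a := fun a b => by
    simpa only [Ideal.span_singleton_le_span_singleton, or_comm] using
      hchain (Ideal.span {a}) (Ideal.span {b})
  have hD : IsCompactOver R H (ι 1) n :=
    { total := hd
      pure := fun _ _ _ h => dvd_of_smul_eq_smul hι hess.1 h
      recursive := hpi.exists_recursive_solution
      limit := fun σ h hc => hpi.exists_pseudo_limit hd σ h hc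
      rank := fun _ x hx => hn.le_of_minimal x hx }
  obtain ⟨m, L, hL, h0, hanti, hs, hlast⟩ :=
    hD.hasSolvableChain (IsLocalRing.maximalIdeal.isMaximal R).isPrime
  have := hL (Fin.last m)
  refine ⟨m, L, hL, h0, hanti, nilradical_le_prime _, fun k => ?_, this,
    isMaximalCR_localization hd _ hlast⟩
  have hle : L k.succ ≤ L k.castSucc := (hanti Fin.castSucc_lt_succ).le
  have := hL k.castSucc
  have hp := Ideal.map_isPrime_of_surjective (f := Ideal.Quotient.mk (L k.succ))
    Ideal.Quotient.mk_surjective (I := L k.castSucc) (by rwa [Ideal.mk_ker])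
  exact ⟨hp, isAlmostMaximalCR_localization hd hle hp (hs k)⟩
end
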